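/- (Cayley–Hamilton–Newton identity, antisymmetric form.) Let R̂ be a Hecke R-matrix for the parameter q with m_q ≠ 0 for all m ≥ 1, let F̂ be a closed R-matrix compatible with R̂, and let M be a matrix of generators of M(R̂,F̂) over a unital associative k-algebra A. Then for every k ≥ 1 the following identity of N×N matrices over A holds: (−1)^{k−1} k_q M^{∧k} = Σ_{i=0}^{k−1} (−q)^i M^{‾(k−i)} σ_i(M). -/

import Mathlib

/-! Common definitions for quantum matrix algebras `M(R̂,F̂)` in the sense of
Isaev–Ogievetsky–Pyatov, "On quantum matrix algebras satisfying the
Cayley-Hamilton-Newton identities".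

We model operators on `V^{⊗m}` (where `dim V = N`) as matrices indexed by
multi-indices `Fin m → Fin N`; entries are taken in a (possibly
noncommutative) unital associative algebra `A` over a field `K`.
Sites (tensor factors) are numbered starting from `0`, so the paper's
`X_i` is `site m (i-1) X`, and the paper's `M_{\overline{k}}` is
`Mbar m F F⁻¹ M (k-1)`. -/

namespace CHN

noncomputable section

/-- Operators on `V^{⊗m}` (`dim V = N`) with entries in a ring `A`. -/
abbrev Op (N : ℕ) (A : Type*) [Ring A] (m : ℕ) :=
  Matrix (Fin m → Fin N) (Fin m → Fin N) A

/-- Operators on `V ⊗ V`. -/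
abbrev M2 (N : ℕ) (A : Type*) [Ring A] :=
  Matrix (Fin N × Fin N) (Fin N × Fin N) A

/-- `site m i X` places the two-site operator `X` at the (0-based) tensor
factors `i, i+1` of `V^{⊗m}`, acting as the identity elsewhere.  In the
paper's 1-based notation, `X_i = site m (i-1) X`.  (Out of range it is the
identity.) -/
def site {A : Type*} [Ring A] {N : ℕ} (m i : ℕ) (X : M2 N A) : Op N A m :=
  fun a b =>
    if h : i + 1 < m then
      X (a ⟨i, Nat.lt_of_succ_lt h⟩, a ⟨i + 1, h⟩)
          (b ⟨i, Nat.lt_of_succ_lt h⟩, b ⟨i + 1, h⟩) *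
        (if ∀ j : Fin m, (j : ℕ) ≠ i → (j : ℕ) ≠ i + 1 → a j = b j then 1 else 0)
    else if a = b then 1 else 0

/-- `site1 m i X` places the one-site operator `X` at the (0-based) factor `i`. -/
def site1 {A : Type*} [Ring A] {N : ℕ} (m i : ℕ) (X : Matrix (Fin N) (Fin N) A) :
    Op N A m :=
  fun a b =>
    if h : i < m then
      X (a ⟨i, h⟩) (b ⟨i, h⟩) *
        (if ∀ j : Fin m, (j : ℕ) ≠ i → a j = b j then 1 else 0)
    else if a = b then 1 else 0

/-- `chain m X i l = X_i X_{i+1} ⋯ X_{i+l-1}` (0-based sites, `l` factors); in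
the paper's 1-based notation this is `X_{i+1 → i+l}`. -/
def chain {A : Type*} [Ring A] {N : ℕ} (m : ℕ) (X : M2 N A) (i : ℕ) :
    ℕ → Op N A m
  | 0 => 1
  | l + 1 => chain m X i l * site m (i + l) X

/-- The Yang–Baxter equation `X₁X₂X₁ = X₂X₁X₂` on `V^{⊗3}`. -/
def YB {A : Type*} [Ring A] {N : ℕ} (X : M2 N A) : Prop :=
  site 3 0 X * site 3 1 X * site 3 0 X = site 3 1 X * site 3 0 X * site 3 1 X

/-- Compatibility of a pair of R-matrices: both Yang–Baxter equations together
with the conditions `R̂₁F̂₂F̂₁ = F̂₂F̂₁R̂₂` and `F̂₁F̂₂R̂₁ = R̂₂F̂₁F̂₂` on `V^{⊗3}`. -/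
def Compatible {A : Type*} [Ring A] {N : ℕ} (R F : M2 N A) : Prop :=
  YB R ∧ YB F ∧
    site 3 0 R * site 3 1 F * site 3 0 F = site 3 1 F * site 3 0 F * site 3 1 R ∧
    site 3 0 F * site 3 1 F * site 3 0 R = site 3 1 R * site 3 0 F * site 3 1 F

/-- `Ψ` witnesses closedness of `F̂`:  `Ψ^{af}_{cg} F̂^{gb}_{fd} = δ^a_d δ^b_c`. -/
def IsClosedPair {A : Type*} [Ring A] {N : ℕ} (F Ψ : M2 N A) : Prop :=
  ∀ a b c d : Fin N,
    (∑ f : Fin N, ∑ g : Fin N, Ψ (a, f) (c, g) * F (g, b) (f, d)) =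
      if a = d ∧ b = c then 1 else 0

/-- The matrix `D`, `D^a_b := Ψ^{ac}_{bc}`. -/
def Dmat {A : Type*} [Ring A] {N : ℕ} (Ψ : M2 N A) : Matrix (Fin N) (Fin N) A :=
  fun a b => ∑ c : Fin N, Ψ (a, c) (b, c)

/-- Quantum trace (with weight `D`) over the last tensor factor. -/
def qtr1 {K : Type*} [Field K] {A : Type*} [Ring A] [Algebra K A] {N m : ℕ}
    (D : Matrix (Fin N) (Fin N) K) (X : Op N A (m + 1)) : Op N A m :=
  fun a b => ∑ c : Fin N, ∑ e : Fin N,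
    algebraMap K A (D c e) * X (Fin.snoc a e) (Fin.snoc b c)

/-- Quantum trace over the last `j` tensor factors. -/
def qtrs {K : Type*} [Field K] {A : Type*} [Ring A] [Algebra K A] {N : ℕ}
    (D : Matrix (Fin N) (Fin N) K) (m : ℕ) :
    (j : ℕ) → Op N A (m + j) → Op N A m
  | 0, X => X
  | j + 1, X => qtrs D m j (qtr1 D X)

/-- Full quantum trace `Tr_F(1,…,m)`, with values in `A`. -/
def qtrAll {K : Type*} [Field K] {A : Type*} [Ring A] [Algebra K A] {N m : ℕ}
    (D : Matrix (Fin N) (Fin N) K) (X : Op N A m) : A :=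
  ∑ a : Fin m → Fin N, ∑ b : Fin m → Fin N,
    algebraMap K A (∏ i, D (a i) (b i)) * X b a

/-- Quantum trace of a one-site operator:  `Tr_F X = Tr (D X)`. -/
def trF {K : Type*} [Field K] {A : Type*} [Ring A] [Algebra K A] {N : ℕ}
    (D : Matrix (Fin N) (Fin N) K) (X : Matrix (Fin N) (Fin N) A) : A :=
  ∑ a : Fin N, ∑ b : Fin N, algebraMap K A (D a b) * X b a

/-- Ordinary partial trace over the last tensor factor. -/
def ptr1 {A : Type*} [Ring A] {N m : ℕ} (X : Op N A (m + 1)) : Op N A m :=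
  fun a b => ∑ c : Fin N, X (Fin.snoc a c) (Fin.snoc b c)

/-- Ordinary partial trace over the last `j` tensor factors. -/
def ptrs {A : Type*} [Ring A] {N : ℕ} (m : ℕ) :
    (j : ℕ) → Op N A (m + j) → Op N A m
  | 0, X => X
  | j + 1, X => ptrs m j (ptr1 X)

/-- `Mbar m F Finv M k` is the paper's `M_{\overline{k+1}}` (0-based index `k`):
`M_{\overline{1}} := M₁` and `M_{\overline{k+1}} := F̂_k M_{\overline{k}} F̂_k⁻¹`. -/
def Mbar {A : Type*} [Ring A] {N : ℕ} (m : ℕ) (F Finv : M2 N A)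
    (M : Matrix (Fin N) (Fin N) A) : ℕ → Op N A m
  | 0 => site1 m 0 M
  | k + 1 => site m k F * Mbar m F Finv M k * site m k Finv

/-- `MbarSeg m F Finv M i l = M_{\overline{i+1}} M_{\overline{i+2}} ⋯ M_{\overline{i+l}}`,
the ordered product of `l` consecutive copies starting at 0-based index `i`.
In particular `MbarSeg m F Finv M 0 k = M_{\overline{1}} ⋯ M_{\overline{k}}`. -/
def MbarSeg {A : Type*} [Ring A] {N : ℕ} (m : ℕ) (F Finv : M2 N A)
    (M : Matrix (Fin N) (Fin N) A) (i : ℕ) : ℕ → Op N A m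
  | 0 => 1
  | l + 1 => MbarSeg m F Finv M i l * Mbar m F Finv M (i + l)

/-- The double twist `R̂^{FF} = F̂ (F̂ R̂ F̂⁻¹) F̂⁻¹`. -/
def RFF {K : Type*} [Field K] {N : ℕ} (R F : M2 N K) : M2 N K :=
  F * (F * R * F⁻¹) * F⁻¹

/-- `M` is a matrix of generators of the algebra `M(R̂,F̂)`:
`R̂₁ M_{\overline{1}} M_{\overline{2}} = M_{\overline{1}} M_{\overline{2}} (R̂^{FF})₁`
on `V ⊗ V`. -/
def IsGenerators {K : Type*} [Field K] {A : Type*} [Ring A] [Algebra K A] {N : ℕ}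
    (R F : M2 N K) (M : Matrix (Fin N) (Fin N) A) : Prop :=
  site 2 0 (R.map (algebraMap K A)) *
      MbarSeg 2 (F.map (algebraMap K A)) ((F⁻¹).map (algebraMap K A)) M 0 2 =
    MbarSeg 2 (F.map (algebraMap K A)) ((F⁻¹).map (algebraMap K A)) M 0 2 *
      site 2 0 ((RFF R F).map (algebraMap K A))

/-- Evaluation of a noncommutative polynomial `Y` in `v` variables, substituting
for the variable `x_j` the operator `R̂` placed at the (0-based) sites
`p+j, p+j+1` of `V^{⊗m}`.  For `p = 0` this is the paper's
`Y^{(v+1)} = Y^{(v+1)}(R̂₁,…,R̂_v)`, and a general `p` gives `Y^{(p+1,v+1)}`. -/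
def evalY {K : Type*} [Field K] {A : Type*} [Ring A] [Algebra K A] {N m v : ℕ}
    (R : M2 N A) (p : ℕ) (Y : FreeAlgebra K (Fin v)) : Op N A m :=
  FreeAlgebra.lift K (fun j : Fin v => site m (p + (j : ℕ)) R) Y

/-- `Ustack m R k l = R̂_{l → l+k-1} ⋯ R̂_{2 → k+1} R̂_{1 → k}` (1-based labels):
the product of `l` descending chains of length `k`. -/
def Ustack {A : Type*} [Ring A] {N : ℕ} (m : ℕ) (R : M2 N A) (k : ℕ) :
    ℕ → Op N A m
  | 0 => 1
  | l + 1 => chain m R l k * Ustack m R k l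

/-- The `q`-number `n_q = (qⁿ − q⁻ⁿ)/(q − q⁻¹)`. -/
def qInt {K : Type*} [Field K] (q : K) (n : ℕ) : K :=
  (q ^ n - q⁻¹ ^ n) / (q - q⁻¹)

/-- `R̂` is a Hecke R-matrix for the parameter `q`:  it is invertible, satisfies
the Yang–Baxter equation and the Hecke condition `R̂² = 1 + (q − q⁻¹)R̂`. -/
def IsHecke {K : Type*} [Field K] {N : ℕ} (q : K) (R : M2 N K) : Prop :=
  IsUnit R ∧ YB R ∧ R * R = 1 + (q - q⁻¹) • R

/-- The `q`-antisymmetrizer `A^{(k)}` built from `R̂`, placed at the (0-based)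
tensor factors `p, p+1, …, p+k-1` of `V^{⊗m}`. -/
def qasym {K : Type*} [Field K] {N : ℕ} (q : K) (R : M2 N K) (m p : ℕ) :
    ℕ → Op N K m
  | 0 => 1
  | 1 => 1
  | k + 2 =>
      (qInt q (k + 2))⁻¹ •
        (qasym q R m p (k + 1) *
          (q ^ (k + 1) • (1 : Op N K m) - qInt q (k + 1) • site m (p + k) R) *
          qasym q R m p (k + 1))

/-- The `q`-symmetrizer `S^{(k)}` built from `R̂`, placed at the (0-based)
tensor factors `p, p+1, …, p+k-1` of `V^{⊗m}`. -/
def qsym {K : Type*} [Field K] {N : ℕ} (q : K) (R : M2 N K) (m p : ℕ) :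
    ℕ → Op N K m
  | 0 => 1
  | 1 => 1
  | k + 2 =>
      (qInt q (k + 2))⁻¹ •
        (qsym q R m p (k + 1) *
          (q⁻¹ ^ (k + 1) • (1 : Op N K m) + qInt q (k + 1) • site m (p + k) R) *
          qsym q R m p (k + 1))

/-- The elementary symmetric function
`σ_k(M) = Tr_F(1,…,k)(A^{(k)} M_{\overline{1}}⋯M_{\overline{k}})` (with `σ_0 = 1`). -/
def sigmaF {K : Type*} [Field K] {A : Type*} [Ring A] [Algebra K A] {N : ℕ}
    (q : K) (R F Ψ : M2 N K) (M : Matrix (Fin N) (Fin N) A) (k : ℕ) : A :=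
  qtrAll (Dmat Ψ)
    ((qasym q R k 0 k).map (algebraMap K A) *
      MbarSeg k (F.map (algebraMap K A)) ((F⁻¹).map (algebraMap K A)) M 0 k)

/-- The complete symmetric function
`τ_k(M) = Tr_F(1,…,k)(S^{(k)} M_{\overline{1}}⋯M_{\overline{k}})` (with `τ_0 = 1`). -/
def tauF {K : Type*} [Field K] {A : Type*} [Ring A] [Algebra K A] {N : ℕ}
    (q : K) (R F Ψ : M2 N K) (M : Matrix (Fin N) (Fin N) A) (k : ℕ) : A :=
  qtrAll (Dmat Ψ)
    ((qsym q R k 0 k).map (algebraMap K A) *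
      MbarSeg k (F.map (algebraMap K A)) ((F⁻¹).map (algebraMap K A)) M 0 k)

/-- The power sums `s_k(M) = Tr_F(1,…,k)(R̂_{1→k−1} M_{\overline{1}}⋯M_{\overline{k}})`,
with `s_0 = 1`. -/
def sF {K : Type*} [Field K] {A : Type*} [Ring A] [Algebra K A] {N : ℕ}
    (R F Ψ : M2 N K) (M : Matrix (Fin N) (Fin N) A) : ℕ → A
  | 0 => 1
  | j + 1 =>
      qtrAll (Dmat Ψ)
        (chain (j + 1) (R.map (algebraMap K A)) 0 j *
          MbarSeg (j + 1) (F.map (algebraMap K A)) ((F⁻¹).map (algebraMap K A)) M 0 (j + 1))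

/-- The `(j+1)`-st quantum power of `M`,
`M^{\overline{j+1}} = Tr_F(2,…,j+1)(R̂_{1→j} M_{\overline{1}}⋯M_{\overline{j+1}})`,
as a one-site operator (so `MpowF R F Ψ M 0 = M₁ = M`). -/
def MpowF {K : Type*} [Field K] {A : Type*} [Ring A] [Algebra K A] {N : ℕ}
    (R F Ψ : M2 N K) (M : Matrix (Fin N) (Fin N) A) (j : ℕ) : Op N A 1 :=
  qtrs (Dmat Ψ) 1 j
    (chain (1 + j) (R.map (algebraMap K A)) 0 j *
      MbarSeg (1 + j) (F.map (algebraMap K A)) ((F⁻¹).map (algebraMap K A)) M 0 (j + 1))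

/-- The `(j+1)`-st wedge power of `M`,
`M^{∧(j+1)} = Tr_F(2,…,j+1)(A^{(j+1)} M_{\overline{1}}⋯M_{\overline{j+1}})`. -/
def MwedgeF {K : Type*} [Field K] {A : Type*} [Ring A] [Algebra K A] {N : ℕ}
    (q : K) (R F Ψ : M2 N K) (M : Matrix (Fin N) (Fin N) A) (j : ℕ) : Op N A 1 :=
  qtrs (Dmat Ψ) 1 j
    ((qasym q R (1 + j) 0 (j + 1)).map (algebraMap K A) *
      MbarSeg (1 + j) (F.map (algebraMap K A)) ((F⁻¹).map (algebraMap K A)) M 0 (j + 1))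

/-- The `(j+1)`-st symmetric power of `M`,
`M^{S(j+1)} = Tr_F(2,…,j+1)(S^{(j+1)} M_{\overline{1}}⋯M_{\overline{j+1}})`. -/
def MsymF {K : Type*} [Field K] {A : Type*} [Ring A] [Algebra K A] {N : ℕ}
    (q : K) (R F Ψ : M2 N K) (M : Matrix (Fin N) (Fin N) A) (j : ℕ) : Op N A 1 :=
  qtrs (Dmat Ψ) 1 j
    ((qsym q R (1 + j) 0 (j + 1)).map (algebraMap K A) *
      MbarSeg (1 + j) (F.map (algebraMap K A)) ((F⁻¹).map (algebraMap K A)) M 0 (j + 1))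

/-- `M^{\overline{0}} := q^{-n} n_q Tr_{(2,…,n)}(A^{(n)}) D^{-1}`, with `n = n0 + 1`
(an ordinary, non-quantum, trace over the factors `2,…,n`). -/
def MzeroF {K : Type*} [Field K] {N : ℕ} (q : K) (R Ψ : M2 N K) (n0 : ℕ) :
    Op N K 1 :=
  (q⁻¹ ^ (n0 + 1) * qInt q (n0 + 1)) •
    (ptrs 1 n0 (qasym q R (1 + n0) 0 (n0 + 1)) * site1 1 0 ((Dmat Ψ)⁻¹))

/-- The generators of the characteristic subalgebra: all elements
`α(Y^{(k)}) = Tr_F(1,…,k)(Y^{(k)} M_{\overline{1}}⋯M_{\overline{k}})`, `k ≥ 1`. -/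
def charSet {K : Type*} [Field K] {A : Type*} [Ring A] [Algebra K A] {N : ℕ}
    (R F Ψ : M2 N K) (M : Matrix (Fin N) (Fin N) A) : Set A :=
  { x : A | ∃ (v : ℕ) (Y : FreeAlgebra K (Fin v)),
      x = qtrAll (Dmat Ψ)
        (evalY (R.map (algebraMap K A)) 0 Y *
          MbarSeg (v + 1) (F.map (algebraMap K A)) ((F⁻¹).map (algebraMap K A)) M 0 (v + 1)) }

end

section Windows

variable {A : Type*} [Ring A] {N n w : ℕ}

/-- The restriction of a multi-index to the window `i, …, i + w - 1`. -/
def res (i : ℕ) (h : i + w ≤ n) (a : Fin n → Fin N) : Fin w → Fin N :=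
  fun t => a ⟨i + t, by omega⟩

/-- The multi-index `a` with its entries in the window `i, …, i + w - 1` replaced by `u`. -/
def ov (i : ℕ) (a : Fin n → Fin N) (u : Fin w → Fin N) : Fin n → Fin N :=
  fun j => if h : i ≤ (j : ℕ) ∧ (j : ℕ) < i + w then u ⟨j - i, by omega⟩ else a j

/-- `a` and `b` agree outside the window `i, …, i + w - 1`. -/
def AgreeOff (i w : ℕ) (a b : Fin n → Fin N) : Prop :=
  ∀ j : Fin n, ((j : ℕ) < i ∨ i + w ≤ (j : ℕ)) → a j = b j

instance (i w : ℕ) (a b : Fin n → Fin N) : Decidable (AgreeOff i w a b) := by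
  unfold AgreeOff; infer_instance

/-- The operator on `V^{⊗n}` acting as `X` on the window `i, …, i + w - 1` and as the identity
elsewhere. -/
def win (n i : ℕ) (h : i + w ≤ n) (X : Op N A w) : Op N A n :=
  fun a b => if AgreeOff i w a b then X (res i h a) (res i h b) else 0

theorem res_ov (i : ℕ) (h : i + w ≤ n) (a : Fin n → Fin N) (u : Fin w → Fin N) :
    res i h (ov i a u) = u := by
  funext t; simp [res, ov]

theorem ov_res (i : ℕ) (h : i + w ≤ n) {a b : Fin n → Fin N} (hab : AgreeOff i w a b) :
    ov i a (res i h b) = b := by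
  funext j
  simp only [ov, res]
  split_ifs with hj
  · congr 1; ext; simp; omega
  · exact hab j (by omega)

theorem ov_ov (i : ℕ) (a : Fin n → Fin N) (u v : Fin w → Fin N) :
    ov i (ov i a u) v = ov i a v := by
  funext j; simp only [ov]; split_ifs <;> rfl

theorem agreeOff_ov (i : ℕ) (a : Fin n → Fin N) (u : Fin w → Fin N) :
    AgreeOff i w a (ov i a u) := by
  intro j hj; simp only [ov]; rw [dif_neg (by omega)]

theorem AgreeOff.symm {i w : ℕ} {a b : Fin n → Fin N} (h : AgreeOff i w a b) :
    AgreeOff i w b a := fun j hj => (h j hj).symm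

theorem AgreeOff.trans {i w : ℕ} {a b c : Fin n → Fin N} (h : AgreeOff i w a b)
    (h' : AgreeOff i w b c) : AgreeOff i w a c := fun j hj => (h j hj).trans (h' j hj)

theorem agreeOff_ov_left (i : ℕ) (a b : Fin n → Fin N) (u : Fin w → Fin N) :
    AgreeOff i w (ov i a u) b ↔ AgreeOff i w a b :=
  ⟨fun h => (agreeOff_ov i a u).trans h, fun h => (agreeOff_ov i a u).symm.trans h⟩

theorem eq_of_res {i : ℕ} (h : i + w ≤ n) {a b : Fin n → Fin N} (hab : AgreeOff i w a b)
    (hr : res i h a = res i h b) : a = b := by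
  rw [← ov_res i h hab, ← hr]
  exact (ov_res i h (fun _ _ => rfl)).symm

theorem sum_agreeOff (i : ℕ) (h : i + w ≤ n) (a : Fin n → Fin N) (G : (Fin n → Fin N) → A) :
    ∑ c, (if AgreeOff i w a c then G c else 0) = ∑ u : Fin w → Fin N, G (ov i a u) := by
  rw [← Finset.sum_filter]
  refine Finset.sum_nbij' (res i h) (ov i a) ?_ ?_ ?_ ?_ ?_
  · simp
  · simp [agreeOff_ov]
  · intro c hc; exact ov_res i h (by simpa using hc)
  · intro u _; exact res_ov i h a u
  · intro c hc; rw [ov_res i h (by simpa using hc)]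

theorem win_mul_apply (i : ℕ) (h : i + w ≤ n) (X : Op N A w) (Y : Op N A n)
    (a b : Fin n → Fin N) :
    (win n i h X * Y) a b = ∑ u, X (res i h a) u * Y (ov i a u) b := by
  have := sum_agreeOff i h a fun c => X (res i h a) (res i h c) * Y c b
  simp only [res_ov] at this
  rw [Matrix.mul_apply, ← this]
  exact Finset.sum_congr rfl fun c _ => by simp only [win]; split_ifs <;> simp

theorem mul_win_apply (i : ℕ) (h : i + w ≤ n) (X : Op N A w) (Y : Op N A n)
    (a b : Fin n → Fin N) :
    (Y * win n i h X) a b = ∑ u, Y a (ov i b u) * X u (res i h b) := by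
  have := sum_agreeOff i h b fun c => Y a c * X (res i h c) (res i h b)
  simp only [res_ov] at this
  rw [Matrix.mul_apply, ← this]
  refine Finset.sum_congr rfl fun c _ => ?_
  simp only [win, show AgreeOff i w c b ↔ AgreeOff i w b c from ⟨.symm, .symm⟩]
  split_ifs <;> simp

theorem win_mul (i : ℕ) (h : i + w ≤ n) (X Y : Op N A w) :
    win n i h (X * Y) = win n i h X * win n i h Y := by
  ext a b
  rw [win_mul_apply]
  simp only [win, agreeOff_ov_left, res_ov, Matrix.mul_apply]
  split_ifs <;> simp

theorem win_one (i : ℕ) (h : i + w ≤ n) : win n i h (1 : Op N A w) = 1 := by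
  ext a b
  simp only [win, Matrix.one_apply]
  by_cases hab : a = b
  · subst hab; simp [AgreeOff]
  · rw [if_neg hab]
    split_ifs with h1 h2
    · exact absurd (eq_of_res h h1 h2) hab
    · rfl
    · rfl

theorem win_add (i : ℕ) (h : i + w ≤ n) (X Y : Op N A w) :
    win n i h (X + Y) = win n i h X + win n i h Y := by
  ext a b; simp only [win, Matrix.add_apply]; split_ifs <;> simp

theorem win_sub (i : ℕ) (h : i + w ≤ n) (X Y : Op N A w) :
    win n i h (X - Y) = win n i h X - win n i h Y := by
  ext a b; simp only [win, Matrix.sub_apply]; split_ifs <;> simp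

theorem win_smul {K : Type*} [Field K] [Algebra K A] (i : ℕ) (h : i + w ≤ n) (c : K)
    (X : Op N A w) : win n i h (c • X) = c • win n i h X := by
  ext a b; simp only [win, Matrix.smul_apply]; split_ifs <;> simp

theorem win_map {K : Type*} [Field K] [Algebra K A] (i : ℕ) (h : i + w ≤ n) (X : Op N K w) :
    win n i h (X.map (algebraMap K A)) = (win n i h X).map (algebraMap K A) := by
  ext a b; simp only [win, Matrix.map_apply]; split_ifs <;> simp

theorem win_win {v : ℕ} (i l : ℕ) (h : i + w ≤ n) (h' : l + v ≤ w) (X : Op N A v) :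
    win n i h (win w l h' X) = win n (i + l) (by omega) X := by
  ext a b
  have e : ∀ a : Fin n → Fin N, res l h' (res i h a) = res (i + l) (by omega) a := by
    intro a; funext t; simp only [res]; congr 1; ext; simp; omega
  have key : (AgreeOff i w a b ∧ AgreeOff l v (res i h a) (res i h b)) ↔
      AgreeOff (i + l) v a b := by
    constructor
    · rintro ⟨h1, h2⟩ j hj
      by_cases hw : (j : ℕ) < i ∨ i + w ≤ j
      · exact h1 j hw
      · have := h2 ⟨j - i, by omega⟩ (by simp only; omega)
        simp only [res] at this
        convert this using 2 <;> (ext; simp; omega)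
    · intro h1
      exact ⟨fun j hj => h1 j (by omega), fun j hj => h1 ⟨i + j, by omega⟩ (by simp only; omega)⟩
  simp only [win, e]
  rw [← ite_and]
  exact if_congr key rfl rfl

theorem win_commute {v : ℕ} {i l : ℕ} (h : i + w ≤ n) (h' : l + v ≤ n) (hil : i + w ≤ l)
    (X : Op N A w) (Y : Op N A v) (hXY : ∀ a b c d, Commute (X a b) (Y c d)) :
    Commute (win n i h X) (win n l h' Y) := by
  have e : ∀ (a : Fin n → Fin N) (u : Fin w → Fin N), res l h' (ov i a u) = res l h' a := by
    intro a u; funext t; simp only [res, ov]; rw [dif_neg (by omega)]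
  ext a b
  rw [win_mul_apply, mul_win_apply]
  by_cases hab : ∀ j : Fin n, ¬ (i ≤ (j : ℕ) ∧ (j : ℕ) < i + w) →
      ¬ (l ≤ (j : ℕ) ∧ (j : ℕ) < l + v) → a j = b j
  · rw [Finset.sum_eq_single (res i h b), Finset.sum_eq_single (res i h a)]
    · have h1 : AgreeOff l v (ov i a (res i h b)) b := by
        intro j hj
        simp only [ov, res]
        split_ifs with h2
        · congr 1; ext; simp; omega
        · exact hab j h2 (by omega)
      have h2 : AgreeOff l v a (ov i b (res i h a)) := by
        intro j hj
        simp only [ov, res]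
        split_ifs with h2
        · congr 1; ext; simp; omega
        · exact hab j h2 (by omega)
      simp only [win, if_pos h1, if_pos h2, e]
      exact hXY _ _ _ _
    · intro u _ hu
      have : ¬ AgreeOff l v a (ov i b u) := by
        intro h1
        apply hu
        funext t
        have := h1 ⟨i + t, by omega⟩ (by simp only; omega)
        simpa [ov, res] using this.symm
      simp [win, this]
    · simp
    · intro u _ hu
      have : ¬ AgreeOff l v (ov i a u) b := by
        intro h1
        apply hu
        funext t
        have := h1 ⟨i + t, by omega⟩ (by simp only; omega)
        simpa [ov, res] using this
      simp [win, this]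
    · simp
  · push Not at hab
    obtain ⟨j, hj1, hj2, hj⟩ := hab
    rw [Finset.sum_eq_zero, Finset.sum_eq_zero]
    · intro u _
      have : ¬ AgreeOff l v a (ov i b u) := by
        intro h1
        have := h1 j (by omega)
        simp only [ov] at this
        rw [dif_neg (by omega)] at this
        exact hj this
      simp [win, this]
    · intro u _
      have : ¬ AgreeOff l v (ov i a u) b := by
        intro h1
        have := h1 j (by omega)
        simp only [ov] at this
        rw [dif_neg (by omega)] at this
        exact hj this
      simp [win, this]

/-- A two-site operator as an operator on `V^{⊗2}`. -/
def toOp2 (X : M2 N A) : Op N A 2 := X.submatrix (finTwoArrowEquiv _) (finTwoArrowEquiv _)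

theorem site_eq_win {i : ℕ} (h : i + 2 ≤ n) (X : M2 N A) :
    site n i X = win n i h (toOp2 X) := by
  ext a b
  simp only [site, dif_pos (show i + 1 < n by omega), win, toOp2, Matrix.submatrix_apply,
    finTwoArrowEquiv]
  have : (∀ j : Fin n, (j : ℕ) ≠ i → (j : ℕ) ≠ i + 1 → a j = b j) ↔ AgreeOff i 2 a b :=
    ⟨fun H j hj => H j (by omega) (by omega), fun H j h1 h2 => H j (by omega)⟩
  simp only [this]
  split_ifs <;> simp [res]

theorem site1_eq_win {i : ℕ} (h : i + 1 ≤ n) (X : Matrix (Fin N) (Fin N) A) :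
    site1 n i X = win n i h (X.submatrix (fun a : Fin 1 → Fin N => a 0) fun a => a 0) := by
  ext a b
  simp only [site1, dif_pos (show i < n by omega), win, Matrix.submatrix_apply, res]
  have : (∀ j : Fin n, (j : ℕ) ≠ i → a j = b j) ↔ AgreeOff i 1 a b :=
    ⟨fun H j hj => H j (by omega), fun H j h1 => H j (by omega)⟩
  simp only [this]
  split_ifs <;> simp

theorem win_site {i l : ℕ} (h : i + w ≤ n) (hl : l + 2 ≤ w) (X : M2 N A) :
    win n i h (site w l X) = site n (i + l) X := by
  rw [site_eq_win hl, win_win, site_eq_win]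

theorem win_site1 {i l : ℕ} (h : i + w ≤ n) (hl : l + 1 ≤ w) (X : Matrix (Fin N) (Fin N) A) :
    win n i h (site1 w l X) = site1 n (i + l) X := by
  rw [site1_eq_win hl, win_win, site1_eq_win]

theorem site_mul {i : ℕ} (X Y : M2 N A) :
    site n i (X * Y) = site n i X * site n i Y := by
  by_cases h : i + 2 ≤ n
  · simp only [site_eq_win h, ← win_mul, toOp2, Matrix.submatrix_mul_equiv]
  · have : ∀ X : M2 N A, site n i X = 1 := fun X => by
      ext a b; simp [site, show ¬ i + 1 < n by omega, Matrix.one_apply]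
    simp [this]

theorem site_one {i : ℕ} : site n i (1 : M2 N A) = 1 := by
  by_cases h : i + 2 ≤ n
  · rw [site_eq_win h, toOp2, Matrix.submatrix_one_equiv, win_one]
  · ext a b; simp [site, show ¬ i + 1 < n by omega, Matrix.one_apply]

theorem site_add {i : ℕ} (h : i + 2 ≤ n) (X Y : M2 N A) :
    site n i (X + Y) = site n i X + site n i Y := by
  simp only [site_eq_win h, ← win_add]; rfl

theorem site_smul {K : Type*} [Field K] [Algebra K A] {i : ℕ} (h : i + 2 ≤ n) (c : K)
    (X : M2 N A) : site n i (c • X) = c • site n i X := by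
  simp only [site_eq_win h, ← win_smul]; rfl

theorem site_map {K : Type*} [Field K] [Algebra K A] {i : ℕ} (X : M2 N K) :
    site n i (X.map (algebraMap K A)) = (site n i X).map (algebraMap K A) := by
  ext a b; simp only [site, Matrix.map_apply]; split_ifs <;> simp

theorem site_commute {K : Type*} [Field K] {i l : ℕ} (hil : i + 2 ≤ l) (hl : l + 2 ≤ n)
    (X Y : M2 N K) : Commute (site n i X) (site n l Y) := by
  rw [site_eq_win (show i + 2 ≤ n by omega), site_eq_win hl]
  exact win_commute _ _ hil _ _ fun _ _ _ _ => Commute.all _ _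

end Windows

section Antisymmetrizers

variable {K : Type*} [Field K] {N n : ℕ} {q : K} {R : M2 N K}

theorem sub_inv_ne_zero (hq0 : q ≠ 0) (hq1 : q ^ 2 ≠ 1) : q - q⁻¹ ≠ 0 := by
  intro h
  apply hq1
  have : q = q⁻¹ := sub_eq_zero.mp h
  rw [pow_two]; nth_rw 2 [this]; exact mul_inv_cancel₀ hq0

theorem qInt_succ (hq0 : q ≠ 0) (hq1 : q ^ 2 ≠ 1) (k : ℕ) :
    qInt q (k + 1) = q ^ k + q⁻¹ * qInt q k := by
  have h := sub_inv_ne_zero hq0 hq1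
  unfold qInt
  rw [eq_comm, eq_div_iff h, add_mul, mul_assoc, div_mul_cancel₀ _ h]
  ring

theorem qInt_one (hq0 : q ≠ 0) (hq1 : q ^ 2 ≠ 1) : qInt q 1 = 1 := by
  simp [qInt, div_self (sub_inv_ne_zero hq0 hq1)]

theorem site_hecke (hH : IsHecke q R) {i : ℕ} (h : i + 2 ≤ n) :
    site n i R * site n i R = 1 + (q - q⁻¹) • site n i R := by
  rw [← site_mul, hH.2.2, site_add h, site_smul h, site_one]

theorem site_transport {A : Type*} [Ring A] {n i : ℕ} (h : i + 3 ≤ n)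
    {X₁ X₂ X₃ Y₁ Y₂ Y₃ : M2 N A} {a b c a' b' c' : ℕ}
    (ha : a + 2 ≤ 3) (hb : b + 2 ≤ 3) (hc : c + 2 ≤ 3)
    (ha' : a' + 2 ≤ 3) (hb' : b' + 2 ≤ 3) (hc' : c' + 2 ≤ 3)
    (e : site 3 a X₁ * site 3 b X₂ * site 3 c X₃ =
      site 3 a' Y₁ * site 3 b' Y₂ * site 3 c' Y₃) :
    site n (i + a) X₁ * site n (i + b) X₂ * site n (i + c) X₃ =
      site n (i + a') Y₁ * site n (i + b') Y₂ * site n (i + c') Y₃ := by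
  have := congrArg (win n i h) e
  simpa only [win_mul, win_site h ha, win_site h hb, win_site h hc, win_site h ha',
    win_site h hb', win_site h hc'] using this

theorem site_braid {A : Type*} [Ring A] {R : M2 N A} (hR : YB R) {i : ℕ} (h : i + 3 ≤ n) :
    site n i R * site n (i + 1) R * site n i R =
      site n (i + 1) R * site n i R * site n (i + 1) R :=
  site_transport (a := 0) (b := 1) (c := 0) (a' := 1) (b' := 0) (c' := 1) h
    (by omega) (by omega) (by omega) (by omega) (by omega) (by omega) hR

/-- The Baxterized braid relation for two Hecke generators. -/
theorem baxterized_braid {B : Type*} [Ring B] [Algebra K B] (hq0 : q ≠ 0) (hq1 : q ^ 2 ≠ 1)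
    {a b : B} (ha : a * a = 1 + (q - q⁻¹) • a) (hb : b * b = 1 + (q - q⁻¹) • b)
    (hab : a * b * a = b * a * b) (k : ℕ) :
    (q • 1 - a) * (q ^ (k + 1) • 1 - qInt q (k + 1) • b) * (q ^ k • 1 - qInt q k • a) =
      (q ^ k • 1 - qInt q k • b) * (q ^ (k + 1) • 1 - qInt q (k + 1) • a) * (q • 1 - b) := by
  simp only [sub_mul, mul_sub, smul_mul_assoc, mul_smul_comm, one_mul, mul_one, ha, hb, hab,
    smul_add, smul_sub, qInt_succ hq0 hq1]
  match_scalars <;> field_simp <;> ring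

theorem qasym_succ_succ (hqn : ∀ n : ℕ, 1 ≤ n → qInt q n ≠ 0) (n p k : ℕ) :
    qInt q (k + 2) • qasym q R n p (k + 2) =
      qasym q R n p (k + 1) *
          (q ^ (k + 1) • (1 : Op N K n) - qInt q (k + 1) • site n (p + k) R) *
          qasym q R n p (k + 1) := by
  rw [qasym, smul_smul, mul_inv_cancel₀ (hqn _ (by omega)), one_smul]

/-- Anything commuting with the generators commutes with the antisymmetrizers. -/
theorem commute_qasym (q : K) {X : Op N K n} {p : ℕ} :
    ∀ k : ℕ, (∀ i, p ≤ i → i + 2 ≤ p + k → Commute X (site n i R)) →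
      Commute X (qasym q R n p k)
  | 0, _ => Commute.one_right _
  | 1, _ => Commute.one_right _
  | k + 2, h => by
    have ih := commute_qasym q (k + 1) fun i h1 h2 => h i h1 (by omega)
    refine Commute.smul_right ?_ _
    exact (ih.mul_right (((Commute.one_right X).smul_right _).sub_right
      ((h (p + k) (by omega) (by omega)).smul_right _))).mul_right ih

theorem mul_qasym_of_absorb (hq0 : q ≠ 0) (hq1 : q ^ 2 ≠ 1)
    (hqn : ∀ n : ℕ, 1 ≤ n → qInt q n ≠ 0) {X : Op N K n} {p : ℕ} :
    ∀ k : ℕ, (∀ i, p ≤ i → i + 2 ≤ p + k → X * site n i R = -q⁻¹ • X) →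
      X * qasym q R n p k = X
  | 0, _ => mul_one _
  | 1, _ => mul_one _
  | k + 2, h => by
    have ih := mul_qasym_of_absorb hq0 hq1 hqn (k + 1) fun i h1 h2 => h i h1 (by omega)
    have hk := hqn (k + 2) (by omega)
    rw [qasym, mul_smul_comm, ← mul_assoc, ← mul_assoc, ih, mul_sub, mul_smul_comm,
      mul_smul_comm, mul_one, h (p + k) (by omega) (by omega), sub_mul, smul_mul_assoc,
      smul_mul_assoc, smul_mul_assoc, ih, smul_smul, ← sub_smul, smul_smul]
    rw [show q ^ (k + 1) - qInt q (k + 1) * -q⁻¹ = qInt q (k + 2) by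
      rw [qInt_succ hq0 hq1 (k + 1)]; ring, inv_mul_cancel₀ hk, one_smul]

theorem qasym_mul_of_absorb (hq0 : q ≠ 0) (hq1 : q ^ 2 ≠ 1)
    (hqn : ∀ n : ℕ, 1 ≤ n → qInt q n ≠ 0) {X : Op N K n} {p : ℕ} :
    ∀ k : ℕ, (∀ i, p ≤ i → i + 2 ≤ p + k → site n i R * X = -q⁻¹ • X) →
      qasym q R n p k * X = X
  | 0, _ => one_mul _
  | 1, _ => one_mul _
  | k + 2, h => by
    have ih := qasym_mul_of_absorb hq0 hq1 hqn (k + 1) fun i h1 h2 => h i h1 (by omega)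
    have hk := hqn (k + 2) (by omega)
    rw [qasym, smul_mul_assoc, mul_assoc, ih, mul_assoc, sub_mul, smul_mul_assoc,
      smul_mul_assoc, one_mul, h (p + k) (by omega) (by omega), smul_smul, ← sub_smul,
      mul_smul_comm, ih, smul_smul]
    rw [show q ^ (k + 1) - qInt q (k + 1) * -q⁻¹ = qInt q (k + 2) by
      rw [qInt_succ hq0 hq1 (k + 1)]; ring, inv_mul_cancel₀ hk, one_smul]

theorem projector_mul_self {B : Type*} [Ring B] [Algebra K B] (hq0 : q ≠ 0) {b : B}
    (hb : b * b = 1 + (q - q⁻¹) • b) : (q • 1 - b) * b = -q⁻¹ • (q • 1 - b) := by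
  rw [sub_mul, hb, smul_mul_assoc, one_mul]
  match_scalars <;> field_simp
  ring

theorem self_mul_projector {B : Type*} [Ring B] [Algebra K B] (hq0 : q ≠ 0) {b : B}
    (hb : b * b = 1 + (q - q⁻¹) • b) : b * (q • 1 - b) = -q⁻¹ • (q • 1 - b) := by
  rw [mul_sub, hb, mul_smul_comm, mul_one]
  match_scalars <;> field_simp
  ring

/-- The inductive step in the construction of antisymmetrizers: if `P` is obtained from `Q` by
adjoining the Hecke generator `a`, then adjoining to `P` a further generator `b` that is braided
with `a` and commutes with `Q` gives an element absorbing `b`. -/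
theorem absorb_of_extension {B : Type*} [Ring B] [Algebra K B] (hq0 : q ≠ 0) (hq1 : q ^ 2 ≠ 1)
    (hqn : ∀ n : ℕ, 1 ≤ n → qInt q n ≠ 0) {a b P Q : B}
    (ha : a * a = 1 + (q - q⁻¹) • a) (hb : b * b = 1 + (q - q⁻¹) • b)
    (braid : a * b * a = b * a * b) (hbQ : Commute b Q) (hPQ : P * Q = P) (hQP : Q * P = P)
    (hPa : P * a = -q⁻¹ • P) (haP : a * P = -q⁻¹ • P) (k : ℕ)
    (hP : qInt q (k + 2) • P = Q * (q ^ (k + 1) • 1 - qInt q (k + 1) • a) * Q) :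
    P * (q ^ (k + 2) • 1 - qInt q (k + 2) • b) * P * b =
        -q⁻¹ • (P * (q ^ (k + 2) • 1 - qInt q (k + 2) • b) * P) ∧
      b * (P * (q ^ (k + 2) • 1 - qInt q (k + 2) • b) * P) =
        -q⁻¹ • (P * (q ^ (k + 2) • 1 - qInt q (k + 2) • b) * P) := by
  have h2 : q - -q⁻¹ = qInt q 2 := by
    rw [qInt_succ hq0 hq1 1, qInt_one hq0 hq1]; ring
  have hPa : P * (q • 1 - a) = qInt q 2 • P := by
    rw [mul_sub, hPa, mul_smul_comm, mul_one, ← sub_smul, h2]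
  have haP : (q • 1 - a) * P = qInt q 2 • P := by
    rw [sub_mul, haP, smul_mul_assoc, one_mul, ← sub_smul, h2]
  have hbQ' : ∀ c d : K, Commute (c • 1 - d • b) Q := fun c d =>
    ((Commute.one_left Q).smul_left c).sub_left (hbQ.smul_left d)
  have hbQ1 : Commute (q • 1 - b) Q := by simpa using hbQ' q 1
  have yb1 := baxterized_braid hq0 hq1 ha hb braid (k + 1)
  have yb2 := baxterized_braid hq0 hq1 hb ha braid.symm (k + 1)
  have c2 : qInt q (k + 2) ≠ 0 := hqn _ (by omega)
  have c3 : qInt q 2 ≠ 0 := hqn _ (by omega)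
  set ca := q ^ (k + 1) • (1 : B) - qInt q (k + 1) • a
  set cb := q ^ (k + 2) • (1 : B) - qInt q (k + 2) • b
  have hcb : Commute cb Q := hbQ' _ _
  have right : qInt q 2 • qInt q (k + 2) • (P * cb * P) =
      P * (q ^ (k + 1) • 1 - qInt q (k + 1) • b) *
        (q ^ (k + 2) • 1 - qInt q (k + 2) • a) * Q * (q • 1 - b) := by
    calc _ = qInt q 2 • (P * cb * (Q * ca * Q)) := by rw [← hP, mul_smul_comm]
      _ = qInt q 2 • (P * Q * cb * ca * Q) := by
          rw [mul_assoc P Q cb, ← hcb.eq]; simp only [mul_assoc]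
      _ = P * ((q • 1 - a) * cb * ca) * Q := by
          rw [hPQ, ← smul_mul_assoc, ← smul_mul_assoc, ← smul_mul_assoc, ← hPa]
          simp only [mul_assoc]
      _ = _ := by
          rw [yb1]; simp only [mul_assoc]; rw [hbQ1.eq]
  have left : qInt q 2 • qInt q (k + 2) • (P * cb * P) =
      (q • 1 - b) * Q * (q ^ (k + 2) • 1 - qInt q (k + 2) • a) *
        (q ^ (k + 1) • 1 - qInt q (k + 1) • b) * P := by
    calc _ = qInt q 2 • (Q * ca * Q * (cb * P)) := by
          rw [← hP, smul_mul_assoc, mul_assoc]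
      _ = qInt q 2 • (Q * ca * cb * (Q * P)) := by
          rw [mul_assoc (Q * ca) Q, ← mul_assoc Q cb P, ← hcb.eq]; simp only [mul_assoc]
      _ = Q * (ca * cb * (q • 1 - a)) * P := by
          rw [hQP, ← mul_smul_comm, ← haP]; simp only [mul_assoc]
      _ = _ := by
          rw [← yb2, ← mul_assoc, ← mul_assoc, ← hbQ1.eq]
  have hinj : Function.Injective fun X : B => qInt q 2 • qInt q (k + 2) • X :=
    (smul_right_injective _ c3).comp (smul_right_injective _ c2)
  have rb : P * cb * P * b = -q⁻¹ • (P * cb * P) := by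
    apply hinj
    simp only
    rw [← smul_mul_assoc, ← smul_mul_assoc, smul_comm _ (-q⁻¹), smul_comm _ (-q⁻¹), right,
      mul_assoc, projector_mul_self hq0 hb, mul_smul_comm]
  have lb : b * (P * cb * P) = -q⁻¹ • (P * cb * P) := by
    apply hinj
    simp only
    rw [← mul_smul_comm, ← mul_smul_comm, smul_comm _ (-q⁻¹), smul_comm _ (-q⁻¹), left]
    simp only [mul_assoc]
    rw [← mul_assoc b, self_mul_projector hq0 hb, smul_mul_assoc]
  exact ⟨rb, lb⟩

/-- The antisymmetrizer `A^{(k)}` absorbs the generators inside its range from both sides. -/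
theorem qasym_absorb (hq0 : q ≠ 0) (hq1 : q ^ 2 ≠ 1)
    (hqn : ∀ n : ℕ, 1 ≤ n → qInt q n ≠ 0) (hH : IsHecke q R) {p : ℕ} :
    ∀ k : ℕ, p + k ≤ n → ∀ i, p ≤ i → i + 2 ≤ p + k →
      qasym q R n p k * site n i R = -q⁻¹ • qasym q R n p k ∧
      site n i R * qasym q R n p k = -q⁻¹ • qasym q R n p k
  | 0, _, i, h1, h2 => by omega
  | 1, _, i, h1, h2 => by omega
  | 2, hk, i, h1, h2 => by
    obtain rfl : i = p := by omega
    have e : qasym q R n i 2 = (qInt q 2)⁻¹ • (q • 1 - site n i R) := by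
      simp [qasym, qInt_one hq0 hq1]
    rw [e, smul_mul_assoc, mul_smul_comm, projector_mul_self hq0 (site_hecke hH (by omega)),
      self_mul_projector hq0 (site_hecke hH (by omega)), smul_comm]
    exact ⟨rfl, rfl⟩
  | k + 3, hk, i, h1, h2 => by
    have ih := qasym_absorb hq0 hq1 hqn hH (p := p) (k + 2) (by omega)
    rcases Nat.lt_or_ge i (p + k + 1) with hi | hi
    · obtain ⟨e1, e2⟩ := ih i h1 (by omega)
      constructor
      · rw [qasym, smul_mul_assoc, mul_assoc, e1, mul_smul_comm, smul_comm]
      · rw [qasym, mul_smul_comm, ← mul_assoc, ← mul_assoc, e2, smul_mul_assoc,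
          smul_mul_assoc, smul_comm]
    · obtain rfl : i = p + k + 1 := by omega
      have hPQ := mul_qasym_of_absorb hq0 hq1 hqn (k + 1) fun i h3 h4 => (ih i h3 (by omega)).1
      have hQP := qasym_mul_of_absorb hq0 hq1 hqn (k + 1) fun i h3 h4 => (ih i h3 (by omega)).2
      obtain ⟨rb, lb⟩ := absorb_of_extension hq0 hq1 hqn
        (site_hecke hH (n := n) (i := p + k) (by omega))
        (site_hecke hH (n := n) (i := p + k + 1) (by omega))
        (site_braid hH.2.1 (n := n) (i := p + k) (by omega))
        (commute_qasym q (p := p) (k + 1) fun i _ h4 =>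
          (site_commute (by omega) (by omega) R R).symm) hPQ hQP
        (ih (p + k) (by omega) (by omega)).1 (ih (p + k) (by omega) (by omega)).2 k
        (qasym_succ_succ hqn n p k)
      rw [qasym, smul_mul_assoc, mul_smul_comm, smul_comm (-q⁻¹)]
      exact ⟨congrArg _ rb, congrArg _ lb⟩

theorem qasym_mul_self (hq0 : q ≠ 0) (hq1 : q ^ 2 ≠ 1)
    (hqn : ∀ n : ℕ, 1 ≤ n → qInt q n ≠ 0) (hH : IsHecke q R) {p k : ℕ} (h : p + k ≤ n) :
    qasym q R n p k * qasym q R n p k = qasym q R n p k :=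
  mul_qasym_of_absorb hq0 hq1 hqn k fun i h1 h2 =>
    (qasym_absorb hq0 hq1 hqn hH k h i h1 h2).1

/-- The antisymmetrizers can also be built by extension to the left. -/
theorem qasym_succ_left (hq0 : q ≠ 0) (hq1 : q ^ 2 ≠ 1)
    (hqn : ∀ n : ℕ, 1 ≤ n → qInt q n ≠ 0) (hH : IsHecke q R) {p : ℕ} :
    ∀ k : ℕ, p + k + 2 ≤ n →
      qInt q (k + 2) • qasym q R n p (k + 2) =
        qasym q R n (p + 1) (k + 1) *
          (q ^ (k + 1) • (1 : Op N K n) - qInt q (k + 1) • site n p R) *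
          qasym q R n (p + 1) (k + 1) := by
  intro k
  induction k generalizing p with
  | zero =>
    intro hk
    rw [qasym_succ_succ hqn]
    simp [qasym]
  | succ k ih =>
    intro hk
    have abs := qasym_absorb hq0 hq1 hqn hH (n := n) (p := p + 1) (k + 2) (by omega)
    have hPQ := mul_qasym_of_absorb hq0 hq1 hqn (p := p + 2) (k + 1) fun i h3 h4 =>
      (abs i (by omega) (by omega)).1
    have hQP := qasym_mul_of_absorb hq0 hq1 hqn (p := p + 2) (k + 1) fun i h3 h4 =>
      (abs i (by omega) (by omega)).2
    obtain ⟨-, lb⟩ := absorb_of_extension hq0 hq1 hqn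
      (site_hecke hH (n := n) (i := p + 1) (by omega))
      (site_hecke hH (n := n) (i := p) (by omega))
      (site_braid hH.2.1 (n := n) (i := p) (by omega)).symm
      (commute_qasym q (p := p + 2) (k + 1) fun i h3 h4 =>
        site_commute (by omega) (by omega) R R) hPQ hQP
      (abs (p + 1) (by omega) (by omega)).1 (abs (p + 1) (by omega) (by omega)).2 k
      (ih (p := p + 1) (by omega))
    set P := qasym q R n (p + 1) (k + 2)
    set W := P * (q ^ (k + 2) • (1 : Op N K n) - qInt q (k + 2) • site n p R) * P
    have absA := qasym_absorb hq0 hq1 hqn hH (n := n) (p := p) (k + 3) (by omega)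
    have hAP : qasym q R n p (k + 3) * P = qasym q R n p (k + 3) :=
      mul_qasym_of_absorb hq0 hq1 hqn (p := p + 1) (k + 2) fun i h3 h4 =>
        (absA i (by omega) (by omega)).1
    have hAW : qasym q R n p (k + 3) * W = W := by
      refine qasym_mul_of_absorb hq0 hq1 hqn (k + 3) fun i h3 h4 => ?_
      rcases Nat.eq_or_lt_of_le h3 with rfl | h3
      · exact lb
      · simp only [W]
        rw [← mul_assoc, ← mul_assoc, (abs i h3 (by omega)).2, smul_mul_assoc, smul_mul_assoc]
    change _ = W
    rw [← hAW]
    simp only [W]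
    rw [← mul_assoc, ← mul_assoc, hAP, mul_sub, mul_smul_comm, mul_smul_comm, mul_one,
      (absA p le_rfl (by omega)).1, sub_mul, smul_mul_assoc, smul_mul_assoc, smul_mul_assoc, hAP,
      smul_smul, ← sub_smul]
    congr 1
    rw [qInt_succ hq0 hq1 (k + 2)]; ring

end Antisymmetrizers

section PartialTrace

variable {K : Type*} [Field K] {A : Type*} [Ring A] [Algebra K A] {N n w : ℕ}

/-- The trace with weight `D` over the window `i, …, i + w - 1`, tensored with the identity on
that window. -/
def ptrace (D : Op N K w) (i : ℕ) : Op N A n →ₗ[K] Op N A n where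
  toFun X := Matrix.of fun a b =>
    if ∀ j : Fin n, i ≤ (j : ℕ) → (j : ℕ) < i + w → a j = b j then
      ∑ u, ∑ v, D u v • X (ov i a v) (ov i b u) else 0
  map_add' X Y := by
    ext a b; simp only [Matrix.add_apply, Matrix.of_apply]
    split_ifs
    · simp only [smul_add, Finset.sum_add_distrib]
    · simp
  map_smul' c X := by
    ext a b; simp only [Matrix.smul_apply, RingHom.id_apply, Matrix.of_apply]
    split_ifs
    · simp only [Finset.smul_sum, smul_comm c]
    · simp

theorem ptrace_apply (D : Op N K w) (i : ℕ) (X : Op N A n) (a b : Fin n → Fin N) :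
    ptrace D i X a b =
      if ∀ j : Fin n, i ≤ (j : ℕ) → (j : ℕ) < i + w → a j = b j then
        ∑ u, ∑ v, D u v • X (ov i a v) (ov i b u) else 0 := rfl

theorem ov_comm {v i l : ℕ} (h : i + w ≤ l) (a : Fin n → Fin N) (x : Fin w → Fin N)
    (y : Fin v → Fin N) : ov l (ov i a x) y = ov i (ov l a y) x := by
  funext j; simp only [ov]
  split_ifs <;> first | rfl | omega

theorem res_ov_of_le {v i l : ℕ} (hi : i + w ≤ n) (h : i + w ≤ l) (a : Fin n → Fin N)
    (y : Fin v → Fin N) : res i hi (ov l a y) = res i hi a := by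
  funext t; simp only [res, ov]; rw [dif_neg (by omega)]

theorem ov_apply_of_le {i : ℕ} (a : Fin n → Fin N) (x : Fin w → Fin N) {j : Fin n}
    (h : i + w ≤ (j : ℕ)) : ov i a x j = a j := by
  simp only [ov]; rw [dif_neg (by omega)]

/-- `X` acts as the identity on all tensor factors from the `m`-th on. -/
def Low (n m : ℕ) (X : Op N A n) : Prop :=
  ∃ (h : 0 + m ≤ n) (X' : Op N A m), X = win n 0 h X'

theorem Low.mul {m : ℕ} {X Y : Op N A n} (hX : Low n m X) (hY : Low n m Y) :
    Low n m (X * Y) := by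
  obtain ⟨h, X', rfl⟩ := hX
  obtain ⟨_, Y', rfl⟩ := hY
  exact ⟨h, X' * Y', (win_mul ..).symm⟩

theorem Low.mono {m m' : ℕ} {X : Op N A n} (hX : Low n m X) (h : m ≤ m') (h' : m' ≤ n) :
    Low n m' X := by
  obtain ⟨h0, X', rfl⟩ := hX
  exact ⟨by omega, win m' 0 (by omega) X', (win_win 0 0 (by omega) (by omega) X').symm⟩

theorem low_one {m : ℕ} (h : m ≤ n) : Low n m (1 : Op N A n) :=
  ⟨by omega, 1, (win_one ..).symm⟩

theorem Low.add {m : ℕ} {X Y : Op N A n} (hX : Low n m X) (hY : Low n m Y) :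
    Low n m (X + Y) := by
  obtain ⟨h, X', rfl⟩ := hX
  obtain ⟨_, Y', rfl⟩ := hY
  exact ⟨h, X' + Y', (win_add ..).symm⟩

theorem low_site {m i : ℕ} (h : i + 2 ≤ m) (h' : m ≤ n) (X : M2 N A) :
    Low n m (site n i X) :=
  ⟨by omega, site m i X, by rw [win_site _ h, zero_add]⟩

theorem low_site1 {m i : ℕ} (h : i + 1 ≤ m) (h' : m ≤ n) (X : Matrix (Fin N) (Fin N) A) :
    Low n m (site1 n i X) :=
  ⟨by omega, site1 m i X, by rw [win_site1 _ h, zero_add]⟩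

theorem low_smul_one {m : ℕ} (h : m ≤ n) (c : A) : Low n m (c • (1 : Op N A n)) := by
  refine ⟨by omega, c • 1, ?_⟩
  rw [← win_one 0 (show 0 + m ≤ n by omega)]
  ext a b; simp only [win, Matrix.smul_apply]; split_ifs <;> simp

theorem Low.apply_eq_zero {m : ℕ} {X : Op N A n} (hX : Low n m X) {a b : Fin n → Fin N}
    {j : Fin n} (hj : m ≤ (j : ℕ)) (h : a j ≠ b j) : X a b = 0 := by
  obtain ⟨h0, X', rfl⟩ := hX
  exact if_neg fun H => h (H j (by omega))

theorem Low.apply_ov {m i : ℕ} {X : Op N A n} (hX : Low n m X) (a b : Fin n → Fin N)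
    (u : Fin w → Fin N) (hi : m ≤ i)
    (hab : ∀ j : Fin n, i ≤ (j : ℕ) → (j : ℕ) < i + w → a j = b j) :
    X (ov i a u) (ov i b u) = X a b := by
  obtain ⟨h0, X', rfl⟩ := hX
  have hr : ∀ a : Fin n → Fin N, res 0 h0 (ov i a u) = res 0 h0 a := fun a =>
    res_ov_of_le h0 (by omega) a u
  simp only [win, hr]
  refine if_congr ⟨fun H j hj => ?_, fun H j hj => ?_⟩ rfl rfl
  · by_cases hw : i ≤ (j : ℕ) ∧ (j : ℕ) < i + w
    · exact hab j hw.1 hw.2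
    · simpa [ov, hw] using H j hj
  · simp only [ov]
    split_ifs
    · rfl
    · exact H j hj

theorem ptrace_low_mul (D : Op N K w) {m i : ℕ} (hmi : m ≤ i) {X : Op N A n} (hX : Low n m X)
    (Y : Op N A n) : ptrace D i (X * Y) = X * ptrace D i Y := by
  obtain ⟨h, X', rfl⟩ := hX
  ext a b
  rw [win_mul_apply, ptrace_apply]
  have hc : ∀ u : Fin m → Fin N,
      (∀ j : Fin n, i ≤ (j : ℕ) → (j : ℕ) < i + w → ov 0 a u j = b j) ↔
      ∀ j : Fin n, i ≤ (j : ℕ) → (j : ℕ) < i + w → a j = b j := fun u =>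
    forall_congr' fun j => forall_congr' fun hj => by rw [ov_apply_of_le a u (by omega)]
  simp only [ptrace_apply, hc, win_mul_apply, res_ov_of_le h (show 0 + m ≤ i by omega),
    ← ov_comm (show 0 + m ≤ i by omega)]
  split_ifs
  · simp only [Finset.mul_sum, Finset.smul_sum, mul_smul_comm]
    simp only [Finset.sum_comm (s := (Finset.univ : Finset (Fin m → Fin N)))]
  · simp

theorem ptrace_mul_low (D : Op N K w) {m i : ℕ} (hmi : m ≤ i) {X : Op N A n} (hX : Low n m X)
    (Y : Op N A n) : ptrace D i (Y * X) = ptrace D i Y * X := by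
  obtain ⟨h, X', rfl⟩ := hX
  ext a b
  rw [mul_win_apply, ptrace_apply]
  have hc : ∀ u : Fin m → Fin N,
      (∀ j : Fin n, i ≤ (j : ℕ) → (j : ℕ) < i + w → a j = ov 0 b u j) ↔
      ∀ j : Fin n, i ≤ (j : ℕ) → (j : ℕ) < i + w → a j = b j := fun u =>
    forall_congr' fun j => forall_congr' fun hj => by rw [ov_apply_of_le b u (by omega)]
  simp only [ptrace_apply, hc, mul_win_apply, res_ov_of_le h (show 0 + m ≤ i by omega),
    ← ov_comm (show 0 + m ≤ i by omega)]
  split_ifs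
  · simp only [Finset.sum_mul, Finset.smul_sum, smul_mul_assoc]
    simp only [Finset.sum_comm (s := (Finset.univ : Finset (Fin m → Fin N)))]
  · simp

/-- The weighted trace moves an operator on the traced window cyclically into the weight. -/
theorem ptrace_mul_win (D : Op N K w) {i : ℕ} (h : i + w ≤ n) (S : Op N K w) (X : Op N A n) :
    ptrace D i (X * win n i h (S.map (algebraMap K A))) = ptrace (S * D) i X := by
  ext a b
  simp only [ptrace_apply]
  split_ifs
  · simp only [mul_win_apply, res_ov, ov_ov, Matrix.map_apply]
    simp only [Matrix.mul_apply, Finset.smul_sum, Finset.sum_smul]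
    have e : ∀ u v x, D u v • (X (ov i a v) (ov i b x) * algebraMap K A (S x u)) =
        (S x u * D u v) • X (ov i a v) (ov i b x) := fun u v x => by
      rw [← Algebra.commutes, ← Algebra.smul_def, smul_smul, mul_comm]
    simp only [e]
    rw [Finset.sum_comm]
    rw [Finset.sum_congr rfl fun v _ => Finset.sum_comm]
    rw [Finset.sum_comm]
  · rfl

theorem ptrace_win_mul (D : Op N K w) {i : ℕ} (h : i + w ≤ n) (S : Op N K w) (X : Op N A n) :
    ptrace D i (win n i h (S.map (algebraMap K A)) * X) = ptrace (D * S) i X := by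
  ext a b
  simp only [ptrace_apply]
  split_ifs
  · simp only [win_mul_apply, res_ov, ov_ov, Matrix.map_apply, ← Algebra.smul_def]
    simp only [Matrix.mul_apply, Finset.smul_sum, Finset.sum_smul, smul_smul]
    exact Finset.sum_congr rfl fun u _ => Finset.sum_comm
  · rfl

end PartialTrace

section Closedness

variable {K : Type*} [Field K] {A : Type*} [Ring A] [Algebra K A] {N n : ℕ}

theorem sum_fin_one {B : Type*} [AddCommMonoid B] (f : (Fin 1 → Fin N) → B) :
    ∑ u, f u = ∑ x, f ![x] :=
  (Equiv.sum_comp (Equiv.funUnique (Fin 1) (Fin N)).symm f).symm.trans <|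
    Finset.sum_congr rfl fun x _ => congrArg f <| by ext i; fin_cases i; rfl

theorem sum_fin_two {B : Type*} [AddCommMonoid B] (f : (Fin 2 → Fin N) → B) :
    ∑ u, f u = ∑ x, ∑ y, f ![x, y] := by
  rw [← Equiv.sum_comp (finTwoArrowEquiv (Fin N)).symm f, Fintype.sum_prod_type]
  rfl

theorem site_mul_apply {i : ℕ} (h : i + 2 ≤ n) (X : M2 N A) (Y : Op N A n)
    (a b : Fin n → Fin N) :
    (site n i X * Y) a b =
      ∑ x, ∑ y, X (a ⟨i, by omega⟩, a ⟨i + 1, by omega⟩) (x, y) * Y (ov i a ![x, y]) b := by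
  rw [site_eq_win h, win_mul_apply, sum_fin_two]
  rfl

theorem mul_site_apply {i : ℕ} (h : i + 2 ≤ n) (X : M2 N A) (Y : Op N A n)
    (a b : Fin n → Fin N) :
    (Y * site n i X) a b =
      ∑ x, ∑ y, Y a (ov i b ![x, y]) * X (x, y) (b ⟨i, by omega⟩, b ⟨i + 1, by omega⟩) := by
  rw [site_eq_win h, mul_win_apply, sum_fin_two]
  rfl

/-- The quantum trace with weight `D` over the `m`-th tensor factor, tensored with the identity
on that factor. -/
def trAt (D : Matrix (Fin N) (Fin N) K) (m : ℕ) : Op N A n →ₗ[K] Op N A n :=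
  ptrace (w := 1) (D.submatrix (fun a => a 0) fun a => a 0) m

theorem trAt_apply (D : Matrix (Fin N) (Fin N) K) (m : ℕ) (X : Op N A n)
    (a b : Fin n → Fin N) :
    trAt D m X a b =
      if ∀ j : Fin n, (j : ℕ) = m → a j = b j then
        ∑ c, ∑ e, D c e • X (ov m a ![e]) (ov m b ![c]) else 0 := by
  rw [trAt, ptrace_apply, sum_fin_one]
  simp only [sum_fin_one]
  exact if_congr ⟨fun H j hj => H j (by omega) (by omega), fun H j _ _ => H j (by omega)⟩ rfl rfl

/-- The weight `D ⊗ D` on `V ⊗ V`. -/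
def tensorSq (D : Matrix (Fin N) (Fin N) K) : M2 N K :=
  fun u v => D u.1 v.1 * D u.2 v.2

theorem ov_singleton_singleton (m : ℕ) (a : Fin n → Fin N) (x y : Fin N) :
    ov (m + 1) (ov m a ![x]) ![y] = ov m a ![x, y] := by
  funext j
  simp only [ov]
  by_cases h1 : (j : ℕ) = m
  · simp [h1]
  · by_cases h2 : (j : ℕ) = m + 1
    · simp [h2]
    · rw [dif_neg (by omega), dif_neg (by omega), dif_neg (by omega)]

theorem trAt_trAt (D : Matrix (Fin N) (Fin N) K) (m : ℕ) (X : Op N A n) :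
    trAt D m (trAt D (m + 1) X) = ptrace (toOp2 (tensorSq D)) m X := by
  ext a b
  rw [trAt_apply, ptrace_apply, sum_fin_two]
  simp only [trAt_apply, sum_fin_two, ov_singleton_singleton]
  have hc : ∀ x y : Fin N, (∀ j : Fin n, (j : ℕ) = m + 1 → ov m a ![x] j = ov m b ![y] j) ↔
      ∀ j : Fin n, (j : ℕ) = m + 1 → a j = b j := fun x y =>
    forall_congr' fun j => forall_congr' fun hj => by
      rw [ov_apply_of_le a _ (by omega), ov_apply_of_le b _ (by omega)]
  simp only [hc]
  by_cases h1 : ∀ j : Fin n, (j : ℕ) = m + 1 → a j = b j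
  · have : (∀ j : Fin n, (j : ℕ) = m → a j = b j) ↔
        ∀ j : Fin n, m ≤ (j : ℕ) → (j : ℕ) < m + 2 → a j = b j :=
      ⟨fun H j _ _ => if hj : (j : ℕ) = m then H j hj else h1 j (by omega),
        fun H j hj => H j (by omega) (by omega)⟩
    simp only [if_pos h1, this]
    refine if_congr Iff.rfl (Finset.sum_congr rfl fun c _ => ?_) rfl
    simp only [Finset.smul_sum, smul_smul]
    exact Finset.sum_comm
  · simp only [if_neg h1, smul_zero, Finset.sum_const_zero, ite_self]
    rw [if_neg fun H => h1 fun j hj => H j (by omega) (by omega)]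

theorem sum_comm_pairs {B I J : Type*} [AddCommMonoid B] [Fintype I] [Fintype J]
    (f : I → I → J → J → B) : ∑ a, ∑ b, ∑ c, ∑ d, f a b c d = ∑ c, ∑ d, ∑ a, ∑ b, f a b c d :=
  calc _ = ∑ a, ∑ c, ∑ b, ∑ d, f a b c d := Finset.sum_congr rfl fun _ _ => Finset.sum_comm
    _ = ∑ c, ∑ a, ∑ b, ∑ d, f a b c d := Finset.sum_comm
    _ = ∑ c, ∑ a, ∑ d, ∑ b, f a b c d :=
      Finset.sum_congr rfl fun _ _ => Finset.sum_congr rfl fun _ _ => Finset.sum_comm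
    _ = _ := Finset.sum_congr rfl fun _ _ => Finset.sum_comm

/-- Skew-invertibility of `F`, as an elimination rule. -/
theorem IsClosedPair.eq_zero {F Ψ : M2 N K} (hΨ : IsClosedPair F Ψ) {H : Fin N → Fin N → K}
    (h : ∀ g f, ∑ b, ∑ d, F (g, b) (f, d) * H b d = 0) (b d : Fin N) : H b d = 0 := by
  calc H b d = ∑ b', ∑ d', (if d = d' ∧ b' = b then 1 else 0) * H b' d' := by
        rw [Finset.sum_eq_single b (by intro x _ hx; simp [hx]) (by simp)]
        simp
    _ = ∑ f, ∑ g, Ψ (d, f) (b, g) * ∑ b', ∑ d', F (g, b') (f, d') * H b' d' := by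
        simp only [← hΨ d _ b _, Finset.sum_mul, Finset.mul_sum, mul_assoc]
        exact sum_comm_pairs _
    _ = 0 := by simp only [h, mul_zero, Finset.sum_const_zero]

/-- `Tr_F(2) F̂ = 1`. -/
theorem IsClosedPair.sum_mul_dmat {F Ψ : M2 N K} (hΨ : IsClosedPair F Ψ) (g f : Fin N) :
    ∑ b, ∑ d, F (g, b) (f, d) * Dmat Ψ d b = if g = f then 1 else 0 := by
  let P : Matrix (Fin N × Fin N) (Fin N × Fin N) K := fun x y => Ψ (x.1, y.1) (x.2, y.2)
  let Q : Matrix (Fin N × Fin N) (Fin N × Fin N) K := fun x y => F (x.2, y.2) (x.1, y.1)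
  have hPQ : P * Q = 1 := by
    ext x y
    rw [Matrix.mul_apply, Fintype.sum_prod_type, Matrix.one_apply]
    refine (hΨ x.1 y.2 x.2 y.1).trans (if_congr ?_ rfl rfl)
    rw [Prod.ext_iff, @eq_comm _ y.2]
  have hQP : Q * P = 1 := mul_eq_one_comm.mp hPQ
  have key : ∀ e, ∑ d, ∑ b, F (g, b) (f, d) * Ψ (d, e) (b, e) =
      if (f, g) = (e, e) then 1 else 0 := fun e => by
    rw [← Fintype.sum_prod_type', ← Matrix.one_apply, ← hQP]
    rfl
  calc _ = ∑ e, ∑ d, ∑ b, F (g, b) (f, d) * Ψ (d, e) (b, e) := by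
        simp only [Dmat, Finset.mul_sum]
        simp only [← Fintype.sum_prod_type']
        exact Fintype.sum_equiv ⟨fun x => ⟨x.2.2, x.2.1, x.1⟩,
          fun x => ⟨x.2.2, x.2.1, x.1⟩, fun _ => rfl, fun _ => rfl⟩ _ _ fun _ => rfl
    _ = _ := by
        simp only [key, Prod.mk.injEq]
        rw [Finset.sum_eq_single f (by intro x _ hx; simp [hx.symm]) (by simp)]
        simp

theorem site_one_apply {i : ℕ} (h : i + 2 ≤ n) (X : M2 N A) (a b : Fin n → Fin N) :
    site n i X a b = if AgreeOff i 2 a b then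
      X (a ⟨i, by omega⟩, a ⟨i + 1, by omega⟩) (b ⟨i, by omega⟩, b ⟨i + 1, by omega⟩) else 0 := by
  rw [site_eq_win h]; rfl

theorem ov_pair_left {i : ℕ} {x : Fin N} (a : Fin n → Fin N) (h : i + 1 < n) :
    ov (i + 1) a ![x] ⟨i, by omega⟩ = a ⟨i, by omega⟩ := by simp [ov]

theorem ov_pair_right {i : ℕ} {x : Fin N} (a : Fin n → Fin N) (h : i < n) :
    ov i a ![x] ⟨i, h⟩ = x := by simp [ov]

theorem trAt_site {F Ψ : M2 N K} (hΨ : IsClosedPair F Ψ) {m : ℕ} (h : m + 2 ≤ n) :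
    trAt (Dmat Ψ) (m + 1) (site n m (F.map (algebraMap K A))) = 1 := by
  ext a b
  rw [trAt_apply]
  simp only [site_one_apply h, ov_pair_left _ (show m + 1 < n by omega),
    ov_pair_right _ (show m + 1 < n by omega)]
  have hc : ∀ x y : Fin N, AgreeOff m 2 (ov (m + 1) a ![x]) (ov (m + 1) b ![y]) ↔
      AgreeOff m 2 a b := fun x y =>
    forall_congr' fun j => forall_congr' fun hj => by
      simp only [ov]; rw [dif_neg (by omega), dif_neg (by omega)]
  have key := hΨ.sum_mul_dmat (a ⟨m, by omega⟩) (b ⟨m, by omega⟩)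
  simp only [hc, Matrix.one_apply]
  by_cases hab : AgreeOff m 2 a b
  · simp only [if_pos hab, Matrix.map_apply, Algebra.smul_def, ← map_mul, ← map_sum]
    rw [Finset.sum_comm]
    simp only [mul_comm (Dmat Ψ _ _), key]
    rw [← map_zero (algebraMap K A), ← map_one (algebraMap K A)]
    split_ifs with h1 h2 h3 h4 h5
    · rfl
    · exact absurd (funext fun j : Fin n => if hj : (j : ℕ) < m ∨ m + 2 ≤ (j : ℕ) then hab j hj else
        if hj' : (j : ℕ) = m + 1 then h1 j hj' else by
          convert h2 using 2 <;> (ext; simp; omega)) h3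
    · exact absurd (congrFun h4 _) h2
    · rfl
    · exact absurd (fun j _ => congrFun h5 j) h1
    · rfl
  · have : a ≠ b := fun e => hab fun j _ => congrFun e j
    simp [if_neg hab, this]

end Closedness

section TraceShift

variable {K : Type*} [Field K] {A : Type*} [Ring A] [Algebra K A] {N n : ℕ} {F Ψ : M2 N K}

theorem site_mul_site_inv (hF : IsUnit F) (i : ℕ) : site n i F * site n i F⁻¹ = 1 := by
  rw [← site_mul, Matrix.mul_nonsing_inv F ((Matrix.isUnit_iff_isUnit_det F).mp hF), site_one]

theorem site_inv_mul_site (hF : IsUnit F) (i : ℕ) : site n i F⁻¹ * site n i F = 1 := by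
  rw [← site_mul, Matrix.nonsing_inv_mul F ((Matrix.isUnit_iff_isUnit_det F).mp hF), site_one]

theorem site_map_self (i : ℕ) (X : M2 N K) :
    site n i (X.map (algebraMap K K)) = site n i X := by
  rw [site_map]; exact Matrix.map_id _

theorem trAt_site_conj_site (hF : IsUnit F) (hΨ : IsClosedPair F Ψ) (hYB : YB F) :
    trAt (Dmat Ψ) 2 (site 3 1 F * (site 3 0 F * site 3 1 F⁻¹)) = 1 := by
  have e : site 3 1 F * (site 3 0 F * site 3 1 F⁻¹) =
      site 3 0 F⁻¹ * site 3 1 F * site 3 0 F := by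
    calc _ = site 3 0 F⁻¹ * site 3 0 F * site 3 1 F * (site 3 0 F * site 3 1 F⁻¹) := by
          rw [site_inv_mul_site hF, one_mul]
      _ = site 3 0 F⁻¹ * (site 3 0 F * site 3 1 F * site 3 0 F) * site 3 1 F⁻¹ := by
          simp only [mul_assoc]
      _ = site 3 0 F⁻¹ * site 3 1 F * site 3 0 F * (site 3 1 F * site 3 1 F⁻¹) := by
          rw [show site 3 0 F * site 3 1 F * site 3 0 F = _ from hYB]
          simp only [mul_assoc]
      _ = _ := by rw [site_mul_site_inv hF, mul_one]
  rw [e, trAt, ptrace_mul_low _ le_rfl (low_site le_rfl (by omega) F),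
    ptrace_low_mul _ le_rfl (low_site le_rfl (by omega) F⁻¹)]
  have := trAt_site (A := K) hΨ (m := 1) (n := 3) le_rfl
  rw [site_map_self] at this
  rw [← trAt, this, mul_one, site_inv_mul_site hF]

theorem sum_dmat_mul_conj (hF : IsUnit F) (hΨ : IsClosedPair F Ψ) (hYB : YB F)
    (p r x z : Fin N) :
    ∑ c, ∑ e, ∑ y, Dmat Ψ c e * F (p, e) (x, y) * F⁻¹ (z, y) (r, c) =
      if p = r then Dmat Ψ z x else 0 := by
  rw [← sub_eq_zero]
  refine hΨ.eq_zero (H := fun x z => (∑ c, ∑ e, ∑ y, Dmat Ψ c e * F (p, e) (x, y) *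
    F⁻¹ (z, y) (r, c)) - if p = r then Dmat Ψ z x else 0) (fun s t => ?_) x z
  have key := congrFun (congrFun (trAt_site_conj_site hF hΨ hYB) ![s, p, p]) ![t, r, p]
  have hov : ∀ u v w w' : Fin N, ov 2 ![u, v, w] ![w'] = ![u, v, w'] := fun u v w w' => by
    ext j; fin_cases j <;> rfl
  have hov1 : ∀ u v w v' w' : Fin N, ov 1 ![u, v, w] ![v', w'] = ![u, v', w'] :=
    fun u v w v' w' => by ext j; fin_cases j <;> rfl
  have hoff : ∀ u v w u' v' w' : Fin N, AgreeOff 0 2 ![u, v, w] ![u', v', w'] ↔ w = w' :=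
    fun u v w u' v' w' => ⟨fun H => H 2 (by simp), fun H j hj => by
      fin_cases j <;> simp_all⟩
  have hone : (1 : Op N K 3) ![s, p, p] ![t, r, p] =
      if p = r then (if s = t then 1 else 0) else 0 := by
    rw [Matrix.one_apply, ← ite_and]
    refine if_congr ⟨fun H => ⟨congrFun H 1, congrFun H 0⟩, fun H => ?_⟩ rfl rfl
    rw [H.1, H.2]
  rw [trAt_apply, if_pos (by intro j hj; fin_cases j <;> simp_all), hone] at key
  simp only [hov, site_mul_apply (show 1 + 2 ≤ 3 by omega),
    mul_site_apply (show 1 + 2 ≤ 3 by omega), hov1, site_one_apply (show 0 + 2 ≤ 3 by omega),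
    hoff, smul_eq_mul] at key
  simp only [ite_mul, zero_mul, Finset.sum_ite_eq, Finset.mem_univ,
    if_true] at key
  simp only [mul_sub, Finset.sum_sub_distrib, sub_eq_zero]
  calc _ = ∑ c, ∑ e, ∑ x, ∑ z, ∑ y, F (s, x) (t, z) *
        (Dmat Ψ c e * F (p, e) (x, y) * F⁻¹ (z, y) (r, c)) := by
        simp only [Finset.mul_sum]
        exact sum_comm_pairs _
    _ = if p = r then if s = t then 1 else 0 else 0 := by
        rw [← key]
        simp only [Finset.mul_sum]
        refine Finset.sum_congr rfl fun c _ => Finset.sum_congr rfl fun e _ =>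
          Finset.sum_congr rfl fun x _ => Finset.sum_comm.trans ?_
        refine Finset.sum_congr rfl fun y _ => Finset.sum_congr rfl fun z _ => ?_
        change _ = Dmat Ψ c e * (F (p, e) (x, y) * (F (s, x) (t, z) * F⁻¹ (z, y) (r, c)))
        ring
    _ = _ := by
        split_ifs with h1 h2
        · rw [hΨ.sum_mul_dmat, if_pos h2]
        · rw [hΨ.sum_mul_dmat, if_neg h2]
        · simp

/-- Conjugation by `F̂` moves the quantum trace by one tensor factor. -/
theorem trAt_conj (hF : IsUnit F) (hΨ : IsClosedPair F Ψ) (hYB : YB F) {m : ℕ}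
    (h : m + 2 ≤ n) {X : Op N A n} (hX : Low n (m + 1) X) :
    trAt (Dmat Ψ) (m + 1) (site n m (F.map (algebraMap K A)) * X *
      site n m (F⁻¹.map (algebraMap K A))) = trAt (Dmat Ψ) m X := by
  ext a b
  rw [mul_assoc]
  simp only [trAt_apply, site_mul_apply h, mul_site_apply h, Matrix.map_apply,
    ov_pair_left _ (show m + 1 < n by omega), ov_pair_right _ (show m + 1 < n by omega)]
  have hov : ∀ (a : Fin n → Fin N) (e x y : Fin N), ov m (ov (m + 1) a ![e]) ![x, y] =
      ov (m + 1) (ov m a ![x]) ![y] := fun a e x y => by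
    rw [ov_singleton_singleton]
    funext j; simp only [ov]; split_ifs <;> first | rfl | omega
  simp only [hov]
  by_cases h1 : ∀ j : Fin n, (j : ℕ) = m + 1 → a j = b j
  · have hXov : ∀ x y z w, X (ov (m + 1) (ov m a ![x]) ![y]) (ov (m + 1) (ov m b ![z]) ![w]) =
        if y = w then X (ov m a ![x]) (ov m b ![z]) else 0 := fun x y z w => by
      split_ifs with hyw
      · subst hyw
        refine hX.apply_ov _ _ _ le_rfl fun j hj hj' => ?_
        rw [ov_apply_of_le a _ hj, ov_apply_of_le b _ hj]
        exact h1 j (by omega)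
      · refine hX.apply_eq_zero (j := ⟨m + 1, by omega⟩) le_rfl ?_
        simpa [ov] using hyw
    have hp : (∀ j : Fin n, (j : ℕ) = m → a j = b j) ↔ a ⟨m, by omega⟩ = b ⟨m, by omega⟩ :=
      ⟨fun H => H _ rfl, fun H j hj => by convert H⟩
    have hb : ∀ c : Fin N, ov (m + 1) b ![c] ⟨m, by omega⟩ = b ⟨m, by omega⟩ := fun c =>
      ov_pair_left b (by omega)
    simp only [if_pos h1, hXov, hp, ite_mul, zero_mul, Finset.sum_ite_eq, Finset.mem_univ, if_true]
    calc _ = ∑ c, ∑ e, ∑ x, ∑ z, ∑ y, (Dmat Ψ c e * F (a ⟨m, by omega⟩, e) (x, y) *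
          F⁻¹ (z, y) (b ⟨m, by omega⟩, c)) • X (ov m a ![x]) (ov m b ![z]) := by
          simp only [Finset.mul_sum, Finset.smul_sum]
          refine Finset.sum_congr rfl fun c _ => Finset.sum_congr rfl fun e _ =>
            Finset.sum_congr rfl fun x _ => Finset.sum_comm.trans ?_
          refine Finset.sum_congr rfl fun z _ => Finset.sum_congr rfl fun y _ => ?_
          rw [← Algebra.commutes, ← Algebra.smul_def, ← Algebra.smul_def, smul_smul, smul_smul,
            mul_assoc]
      _ = ∑ x, ∑ z, (if a ⟨m, by omega⟩ = b ⟨m, by omega⟩ then Dmat Ψ z x else 0) •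
          X (ov m a ![x]) (ov m b ![z]) := by
          rw [sum_comm_pairs]
          simp only [← sum_dmat_mul_conj hF hΨ hYB, Finset.sum_smul]
      _ = _ := by
          split_ifs
          · exact Finset.sum_comm
          · simp
  · rw [if_neg h1]
    split_ifs
    · symm
      push Not at h1
      obtain ⟨j, hj, hj'⟩ := h1
      refine Finset.sum_eq_zero fun c _ => Finset.sum_eq_zero fun e _ => ?_
      rw [hX.apply_eq_zero (j := j) (by omega), smul_zero]
      rwa [ov_apply_of_le a _ (by omega), ov_apply_of_le b _ (by omega)]
    · rfl

end TraceShift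

section Cyclicity

variable {K : Type*} [Field K] {A : Type*} [Ring A] [Algebra K A] {N n : ℕ} {R F Ψ : M2 N K}

theorem site_rff (i : ℕ) : site n i (RFF R F) =
    site n i F * (site n i F * site n i R * site n i F⁻¹) * site n i F⁻¹ := by
  simp only [RFF, site_mul]

theorem site_cross {B : Type*} [Ring B] {R F : M2 N B} (h : Compatible R F) {i : ℕ}
    (hi : i + 3 ≤ n) :
    site n i R * site n (i + 1) F * site n i F =
      site n (i + 1) F * site n i F * site n (i + 1) R :=
  site_transport (a := 0) (b := 1) (c := 0) (a' := 1) (b' := 0) (c' := 1) hi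
    (by omega) (by omega) (by omega) (by omega) (by omega) (by omega) h.2.2.1

theorem site_cross' {B : Type*} [Ring B] {R F : M2 N B} (h : Compatible R F) {i : ℕ}
    (hi : i + 3 ≤ n) :
    site n i F * site n (i + 1) F * site n i R =
      site n (i + 1) R * site n i F * site n (i + 1) F :=
  site_transport (a := 0) (b := 1) (c := 0) (a' := 1) (b' := 0) (c' := 1) hi
    (by omega) (by omega) (by omega) (by omega) (by omega) (by omega) h.2.2.2

theorem ptrace_sub_left {w : ℕ} (D D' : Op N K w) (i : ℕ) (X : Op N A n) :
    ptrace (D - D') i X = ptrace D i X - ptrace D' i X := by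
  ext a b
  simp only [ptrace_apply, Matrix.sub_apply, sub_smul, Finset.sum_sub_distrib]
  split_ifs <;> simp

/-- The braiding of `V ⊗ V` with itself can be eliminated under the trace. -/
theorem eq_zero_of_ptrace_braiding (hΨ : IsClosedPair F Ψ) {P : M2 N K}
    (h : ptrace (toOp2 P) 2 (site 4 1 F * (site 4 0 F * (site 4 2 F * site 4 1 F))) = 0) :
    P = 0 := by
  have h0 : ∀ u v w w' y y' : Fin N, ov 0 ![u, v, w, w'] ![y, y'] = ![y, y', w, w'] :=
    fun u v w w' y y' => by ext j; fin_cases j <;> rfl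
  have h1 : ∀ u v w w' y y' : Fin N, ov 1 ![u, v, w, w'] ![y, y'] = ![u, y, y', w'] :=
    fun u v w w' y y' => by ext j; fin_cases j <;> rfl
  have h2 : ∀ u v w w' y y' : Fin N, ov 2 ![u, v, w, w'] ![y, y'] = ![u, v, y, y'] :=
    fun u v w w' y y' => by ext j; fin_cases j <;> rfl
  have hoff : ∀ u v w w' a b c c' : Fin N, AgreeOff 1 2 ![u, v, w, w'] ![a, b, c, c'] ↔
      w' = c' ∧ u = a := fun u v w w' a b c c' =>
    ⟨fun H => ⟨H 3 (by simp), H 0 (by simp)⟩, fun H j hj => by fin_cases j <;> simp_all⟩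
  have hP : ∀ x y z w, toOp2 P ![x, y] ![z, w] = P (x, y) (z, w) := fun _ _ _ _ => rfl
  have key : ∀ a b a' b' : Fin N, ∑ c, ∑ c', ∑ e, ∑ e', P (c, c') (e, e') *
      ∑ x, ∑ y, F (a', e) (x, y) * ∑ u, F (a, x) (b, u) * ∑ v, F (y, e') (v, c') *
        F (u, v) (b', c) = 0 := fun a b a' b' => by
    have := congrFun (congrFun h ![a, a', a, a]) ![b, b', a, a]
    rw [ptrace_apply, if_pos (by intro j hj hj'; fin_cases j <;> simp_all)] at this
    simp only [sum_fin_two, h2, site_mul_apply (show 1 + 2 ≤ 4 by omega),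
      site_mul_apply (show 0 + 2 ≤ 4 by omega), site_mul_apply (show 2 + 2 ≤ 4 by omega), h0, h1,
      site_one_apply (show 1 + 2 ≤ 4 by omega), hoff, hP, smul_eq_mul, ite_and, mul_ite, mul_zero,
      Finset.sum_ite_eq', Finset.mem_univ, if_true, Finset.sum_ite_irrel, Finset.sum_const_zero] at this
    exact this
  have flat : ∀ a b a' b' : Fin N, ∑ x, ∑ u, F (a, x) (b, u) * ∑ e, ∑ y, F (a', e) (x, y) *
      ∑ v, ∑ c, F (u, v) (b', c) * ∑ e', ∑ c', F (y, e') (v, c') * P (c, c') (e, e') = 0 := by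
    intro a b a' b'
    rw [← key a b a' b']
    let e₁ : Fin N × Fin N × Fin N × Fin N × Fin N × Fin N × Fin N × Fin N ≃
        Fin N × Fin N × Fin N × Fin N × Fin N × Fin N × Fin N × Fin N :=
      ⟨fun (x, u, e, y, v, c, e', c') => (c, c', e, e', x, y, u, v),
        fun (c, c', e, e', x, y, u, v) => (x, u, e, y, v, c, e', c'), fun _ => rfl, fun _ => rfl⟩
    have := Equiv.sum_comp e₁ fun (c, c', e, e', x, y, u, v) => P (c, c') (e, e') *
      (F (a', e) (x, y) * (F (a, x) (b, u) * (F (y, e') (v, c') * F (u, v) (b', c))))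
    simp only [Fintype.sum_prod_type, e₁, Equiv.coe_fn_mk] at this
    simp only [Finset.mul_sum]
    rw [← this]
    iterate 8 refine Finset.sum_congr rfl fun _ _ => ?_
    ring
  ext ⟨c, c'⟩ ⟨e, e'⟩
  refine hΨ.eq_zero (H := fun e' c' => P (c, c') (e, e')) (fun y v => ?_) e' c'
  refine hΨ.eq_zero (H := fun v c => ∑ e', ∑ c', F (y, e') (v, c') * P (c, c') (e, e'))
    (fun u b' => ?_) v c
  refine hΨ.eq_zero (H := fun e y => ∑ v, ∑ c, F (u, v) (b', c) *
    ∑ e', ∑ c', F (y, e') (v, c') * P (c, c') (e, e')) (fun a' x => ?_) e y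
  exact hΨ.eq_zero (H := fun x u => ∑ e, ∑ y, F (a', e) (x, y) * ∑ v, ∑ c, F (u, v) (b', c) *
    ∑ e', ∑ c', F (y, e') (v, c') * P (c, c') (e, e')) (fun a b => flat a b a' b') x u

theorem rff_mul_tensorSq (hF : IsUnit F) (hΨ : IsClosedPair F Ψ) (h : Compatible R F) :
    RFF R F * tensorSq (Dmat Ψ) = tensorSq (Dmat Ψ) * R := by
  set D := Dmat Ψ
  have toOp2_mul : ∀ X Y : M2 N K, toOp2 (X * Y) = toOp2 X * toOp2 Y := fun X Y => by
    simp only [toOp2, Matrix.submatrix_mul_equiv]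
  set Z := site 4 1 F * (site 4 0 F * (site 4 2 F * site 4 1 F)) with hZ
  have far : site 4 0 F * site 4 2 F = site 4 2 F * site 4 0 F :=
    site_commute le_rfl le_rfl F F
  have braid₀ := site_braid (n := 4) h.2.1 (i := 0) (by omega)
  have braid₁ := site_braid (n := 4) h.2.1 (i := 1) le_rfl
  have hRZ : site 4 2 R * Z = Z * site 4 0 R := by
    have h₀ := site_cross' (n := 4) h (i := 0) (by omega)
    have h₁ := site_cross' (n := 4) h (i := 1) le_rfl
    simp only [zero_add, Nat.reduceAdd] at h₀ h₁
    calc _ = site 4 2 R * site 4 1 F * (site 4 0 F * site 4 2 F) * site 4 1 F := by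
          simp only [hZ, mul_assoc]
      _ = site 4 2 R * site 4 1 F * site 4 2 F * site 4 0 F * site 4 1 F := by
          rw [far]; simp only [mul_assoc]
      _ = site 4 1 F * site 4 2 F * (site 4 1 R * site 4 0 F * site 4 1 F) := by
          rw [← h₁]; simp only [mul_assoc]
      _ = site 4 1 F * (site 4 2 F * site 4 0 F) * site 4 1 F * site 4 0 R := by
          rw [← h₀]; simp only [mul_assoc]
      _ = _ := by rw [← far]; simp only [hZ, mul_assoc]
  have hZF : Z * site 4 2 F = site 4 0 F * Z := by
    calc _ = site 4 1 F * site 4 0 F * (site 4 2 F * site 4 1 F * site 4 2 F) := by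
          simp only [hZ, mul_assoc]
      _ = site 4 1 F * site 4 0 F * site 4 1 F * site 4 2 F * site 4 1 F := by
          rw [← braid₁]; simp only [mul_assoc]
      _ = _ := by rw [← braid₀]; simp only [hZ, mul_assoc]
  have hZR : Z * site 4 2 R = site 4 0 R * Z := by
    have h₀ := site_cross (n := 4) h (i := 0) (by omega)
    have h₁ := site_cross (n := 4) h (i := 1) le_rfl
    simp only [zero_add, Nat.reduceAdd] at h₀ h₁
    calc _ = site 4 1 F * site 4 0 F * (site 4 2 F * site 4 1 F * site 4 2 R) := by
          simp only [hZ, mul_assoc]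
      _ = site 4 1 F * site 4 0 F * site 4 1 R * site 4 2 F * site 4 1 F := by
          rw [← h₁]; simp only [mul_assoc]
      _ = _ := by rw [← h₀]; simp only [hZ, mul_assoc]
  have hZF' : Z * site 4 2 F⁻¹ = site 4 0 F⁻¹ * Z := by
    calc _ = site 4 0 F⁻¹ * site 4 0 F * Z * site 4 2 F⁻¹ := by
          rw [site_inv_mul_site hF, one_mul]
      _ = site 4 0 F⁻¹ * (Z * site 4 2 F) * site 4 2 F⁻¹ := by rw [hZF]; simp only [mul_assoc]
      _ = site 4 0 F⁻¹ * Z * (site 4 2 F * site 4 2 F⁻¹) := by simp only [mul_assoc]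
      _ = _ := by rw [site_mul_site_inv hF, mul_one]
  have hZRFF : Z * site 4 2 (RFF R F) = site 4 0 (RFF R F) * Z := by
    have comm : ∀ {a b c d : Op N K 4}, Z * a = b * Z → Z * c = d * Z →
        Z * (a * c) = b * d * Z := fun h h' => by
      rw [← mul_assoc, h, mul_assoc, h', mul_assoc]
    rw [site_rff, site_rff]
    exact comm (comm hZF (comm (comm hZF hZR) hZF')) hZF'
  have htr : ∀ i, i + 2 ≤ 4 → trAt D (i + 1) (site 4 i F) = 1 := fun i hi => by
    simpa [site_map_self] using trAt_site (A := K) hΨ hi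
  have hZtr : trAt D 2 (trAt D 3 Z) = site 4 0 F * site 4 0 F := by
    have low : ∀ {i m}, i + 2 ≤ m → m ≤ 4 → Low 4 m (site 4 i F) := fun h h' => low_site h h' F
    have low₀₂ : Low 4 2 (site 4 0 F) := low (by omega) (by omega)
    have low₀₃ : Low 4 3 (site 4 0 F) := low (by omega) (by omega)
    have low₁₃ : Low 4 3 (site 4 1 F) := low (by omega) (by omega)
    have t₃ : ptrace (D.submatrix (fun a => a 0) (fun a => a 0)) 3 (site 4 2 F) = 1 :=
      htr 2 le_rfl
    have t₂ : ptrace (D.submatrix (fun a => a 0) (fun a => a 0)) 2 (site 4 1 F) = 1 :=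
      htr 1 (by omega)
    have inner : trAt D 3 Z = site 4 0 F * site 4 1 F * site 4 0 F := by
      rw [hZ, trAt, ptrace_low_mul _ le_rfl low₁₃, ptrace_low_mul _ le_rfl low₀₃,
        ptrace_mul_low _ le_rfl low₁₃, t₃, one_mul, ← mul_assoc]
      exact braid₀.symm
    rw [inner, trAt, ptrace_mul_low _ le_rfl low₀₂, ptrace_low_mul _ le_rfl low₀₂, t₂, mul_one]
  have hlow : ∀ X : M2 N K, Low 4 2 (site 4 0 X) := fun X => low_site le_rfl (by omega) X
  rw [← sub_eq_zero]
  refine eq_zero_of_ptrace_braiding hΨ ?_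
  have hsub : ∀ X Y : M2 N K, toOp2 (X - Y) = toOp2 X - toOp2 Y := fun _ _ => rfl
  rw [hsub, ptrace_sub_left, toOp2_mul, toOp2_mul]
  have e₁ := ptrace_mul_win (A := K) (toOp2 (tensorSq D)) (i := 2) (n := 4) le_rfl
    (toOp2 (RFF R F)) Z
  have e₂ := ptrace_win_mul (A := K) (toOp2 (tensorSq D)) (i := 2) (n := 4) le_rfl (toOp2 R) Z
  rw [← e₁, ← e₂, sub_eq_zero]
  have hid : ∀ X : M2 N K, win 4 2 le_rfl ((toOp2 X).map (algebraMap K K)) = site 4 2 X :=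
    fun X => by rw [site_eq_win le_rfl]; rfl
  rw [hid, hid, hZRFF, hRZ, ptrace_low_mul _ le_rfl (hlow _), ptrace_mul_low _ le_rfl (hlow _),
    ← trAt_trAt, hZtr, site_rff]
  simp only [mul_assoc]
  rw [← mul_assoc (site 4 0 F⁻¹) (site 4 0 F) (site 4 0 F), site_inv_mul_site hF, one_mul,
    site_inv_mul_site hF, mul_one]

end Cyclicity

section TraceRange

variable {K : Type*} [Field K] {A : Type*} [Ring A] [Algebra K A] {N n : ℕ} {R F Ψ : M2 N K}

/-- Under the quantum trace, `R̂^{FF}` on the right can be moved to the left, where it becomes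
`R̂`. -/
theorem trAt_trAt_mul_rff (hF : IsUnit F) (hΨ : IsClosedPair F Ψ) (h : Compatible R F) {m : ℕ}
    (hm : m + 2 ≤ n) (X : Op N A n) :
    trAt (Dmat Ψ) m (trAt (Dmat Ψ) (m + 1) (X * site n m ((RFF R F).map (algebraMap K A)))) =
      trAt (Dmat Ψ) m (trAt (Dmat Ψ) (m + 1) (site n m (R.map (algebraMap K A)) * X)) := by
  have hmap : ∀ Y : M2 N K, site n m (Y.map (algebraMap K A)) =
      win n m hm ((toOp2 Y).map (algebraMap K A)) := fun Y => by rw [site_eq_win hm]; rfl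
  have hmul : ∀ Y Z : M2 N K, toOp2 Y * toOp2 Z = toOp2 (Y * Z) := fun Y Z => by
    simp only [toOp2, Matrix.submatrix_mul_equiv]
  rw [trAt_trAt, trAt_trAt, hmap, hmap, ptrace_mul_win, ptrace_win_mul, hmul, hmul,
    rff_mul_tensorSq hF hΨ h]

/-- The quantum trace over the tensor factors `s, …, s + l - 1`. -/
def trRange (D : Matrix (Fin N) (Fin N) K) (s : ℕ) : ℕ → Op N A n →ₗ[K] Op N A n
  | 0 => LinearMap.id
  | l + 1 => trRange D s l ∘ₗ trAt D (s + l)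

theorem trRange_zero (D : Matrix (Fin N) (Fin N) K) (s : ℕ) (X : Op N A n) :
    trRange D s 0 X = X := rfl

theorem trRange_succ (D : Matrix (Fin N) (Fin N) K) (s l : ℕ) (X : Op N A n) :
    trRange D s (l + 1) X = trRange D s l (trAt D (s + l) X) := rfl

theorem trRange_add (D : Matrix (Fin N) (Fin N) K) (s l l' : ℕ) (X : Op N A n) :
    trRange D s (l + l') X = trRange D s l (trRange D (s + l) l' X) := by
  induction l' generalizing X with
  | zero => rfl
  | succ l' ih => rw [← add_assoc, trRange_succ, ih, trRange_succ, add_assoc]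

theorem trRange_low_mul (D : Matrix (Fin N) (Fin N) K) {m s : ℕ} (hms : m ≤ s) (l : ℕ)
    {X : Op N A n} (hX : Low n m X) (Y : Op N A n) :
    trRange D s l (X * Y) = X * trRange D s l Y := by
  induction l generalizing Y with
  | zero => rfl
  | succ l ih => rw [trRange_succ, trAt, ptrace_low_mul _ (by omega) hX, ih]; rfl

theorem trRange_mul_low (D : Matrix (Fin N) (Fin N) K) {m s : ℕ} (hms : m ≤ s) (l : ℕ)
    {X : Op N A n} (hX : Low n m X) (Y : Op N A n) :
    trRange D s l (Y * X) = trRange D s l Y * X := by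
  induction l generalizing Y with
  | zero => rfl
  | succ l ih => rw [trRange_succ, trAt, ptrace_mul_low _ (by omega) hX, ih]; rfl

theorem trRange_mul_rff (hF : IsUnit F) (hΨ : IsClosedPair F Ψ) (h : Compatible R F)
    {s l i : ℕ} (hsi : s ≤ i) (hil : i + 2 ≤ s + l) (hl : s + l ≤ n) (X : Op N A n) :
    trRange (Dmat Ψ) s l (X * site n i ((RFF R F).map (algebraMap K A))) =
      trRange (Dmat Ψ) s l (site n i (R.map (algebraMap K A)) * X) := by
  obtain ⟨d, rfl⟩ := Nat.exists_eq_add_of_le hsi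
  obtain ⟨e, rfl⟩ : ∃ e, l = d + 1 + 1 + e := ⟨l - (d + 2), by omega⟩
  rw [trRange_add, trRange_add _ _ _ _ (site n _ _ * X),
    trRange_mul_low _ (m := s + d + 2) (by omega) _ (low_site le_rfl (by omega) _),
    trRange_low_mul _ (m := s + d + 2) (by omega) _ (low_site le_rfl (by omega) _)]
  simp only [trRange_succ]
  exact congrArg _ (trAt_trAt_mul_rff hF hΨ h (by omega) _)

theorem trAt_win (D : Matrix (Fin N) (Fin N) K) {m : ℕ} (h : 0 + (m + 1) ≤ n)
    (X : Op N A (m + 1)) :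
    trAt D m (win n 0 h X) = win n 0 (by omega) (qtr1 D X) := by
  ext a b
  have hres : ∀ (a : Fin n → Fin N) (e : Fin N),
      res 0 h (ov m a ![e]) = Fin.snoc (res 0 (by omega) a) e := fun a e => by
    funext t
    refine Fin.lastCases ?_ (fun t => ?_) t
    · simp [res, ov]
    · simp [res, ov]
  have hagree : ∀ e c : Fin N, AgreeOff 0 (m + 1) (ov m a ![e]) (ov m b ![c]) ↔
      AgreeOff 0 (m + 1) a b := fun e c =>
    forall_congr' fun j => forall_congr' fun hj => by
      simp only [ov]; rw [dif_neg (by omega), dif_neg (by omega)]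
  rw [trAt_apply]
  simp only [win, hagree, hres, qtr1, ← Algebra.smul_def]
  by_cases h1 : AgreeOff 0 (m + 1) a b
  · have : AgreeOff 0 m a b ↔ ∀ j : Fin n, (j : ℕ) = m → a j = b j :=
      ⟨fun H j hj => H j (by omega), fun H j hj =>
        if hjm : (j : ℕ) = m then H j hjm else h1 j (by omega)⟩
    simp only [if_pos h1, this]
  · rw [if_neg fun H : AgreeOff 0 m a b => h1 fun j hj => H j (by omega)]
    simp [h1]

theorem trRange_win (D : Matrix (Fin N) (Fin N) K) {m j : ℕ} (h : 0 + (m + j) ≤ n)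
    (X : Op N A (m + j)) :
    trRange D m j (win n 0 h X) = win n 0 (by omega) (qtrs D m j X) := by
  induction j with
  | zero => rfl
  | succ j ih =>
    rw [trRange_succ]
    exact (congrArg _ (trAt_win D h X)).trans (ih _ _)

theorem qtrAll_qtr1 (D : Matrix (Fin N) (Fin N) K) {m : ℕ} (X : Op N A (m + 1)) :
    qtrAll D (qtr1 D X) = qtrAll D X := by
  have hsum : ∀ f : (Fin (m + 1) → Fin N) → A,
      ∑ a, f a = ∑ a : Fin m → Fin N, ∑ e, f (Fin.snoc a e) := fun f => by
    rw [← (Fin.snocEquiv fun _ : Fin (m + 1) => Fin N).sum_comp, Fintype.sum_prod_type_right]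
    rfl
  simp only [qtrAll, hsum, qtr1, Fin.prod_univ_castSucc, Fin.snoc_castSucc, Fin.snoc_last,
    Finset.mul_sum, ← Algebra.smul_def, smul_smul]
  refine Finset.sum_congr rfl fun a _ => ?_
  rw [Finset.sum_comm]

theorem trRange_win_zero (D : Matrix (Fin N) (Fin N) K) {m : ℕ} (h : 0 + m ≤ n)
    (X : Op N A m) : trRange D 0 m (win n 0 h X) = qtrAll D X • (1 : Op N A n) := by
  induction m with
  | zero =>
    ext a b
    have : AgreeOff 0 0 a b ↔ a = b :=
      ⟨fun H => funext fun j => H j (by omega), fun H j _ => H ▸ rfl⟩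
    simp only [trRange_zero, win, this, qtrAll, Matrix.smul_apply, Matrix.one_apply]
    split_ifs <;> simp [Subsingleton.elim (res 0 h _) default]
  | succ m ih =>
    rw [trRange_succ, zero_add, trAt_win D h, ih, qtrAll_qtr1]

theorem win_injective {w i : ℕ} (hw : 0 < w) (h : i + w ≤ n) :
    Function.Injective (win n i h : Op N A w → Op N A n) := fun X Y hXY => by
  ext a b
  set c : Fin n → Fin N := fun _ => a ⟨0, hw⟩
  have hab : AgreeOff i w (ov i c a) (ov i c b) :=
    AgreeOff.trans (AgreeOff.symm (agreeOff_ov i c a)) (agreeOff_ov i c b)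
  simpa only [win, if_pos hab, res_ov] using congrFun (congrFun hXY (ov i c a)) (ov i c b)

end TraceRange

section SiteAlgebra

variable {K : Type*} [Field K] {A : Type*} [Ring A] [Algebra K A] {N n : ℕ} {R F Ψ : M2 N K}

/-- Operators with scalar entries, viewed as operators with entries in `A`. -/
noncomputable def scal : Op N K n →ₐ[K] Op N A n := (Algebra.ofId K A).mapMatrix

theorem scal_mul (X Y : Op N K n) : (scal (X * Y) : Op N A n) = scal X * scal Y :=
  map_mul ..

theorem site_scal (i : ℕ) (X : M2 N K) :
    site n i (X.map (algebraMap K A)) = scal (site n i X) := site_map X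

theorem Low.scal {m : ℕ} {X : Op N K n} (hX : Low n m X) : Low n m (scal X : Op N A n) := by
  obtain ⟨h, X', rfl⟩ := hX
  exact ⟨h, X'.map (algebraMap K A), (win_map _ _ _).symm⟩

theorem Low.smul {m : ℕ} {X : Op N A n} (hX : Low n m X) (c : K) : Low n m (c • X) := by
  obtain ⟨h, X', rfl⟩ := hX
  exact ⟨h, c • X', (win_smul _ _ _ _).symm⟩

theorem Low.commute_site {m i : ℕ} {X : Op N A n} (hX : Low n m X) (hmi : m ≤ i)
    (hi : i + 2 ≤ n) (Y : M2 N K) : Commute X (CHN.scal (site n i Y)) := by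
  obtain ⟨h, X', rfl⟩ := hX
  rw [← site_scal, site_eq_win hi]
  exact win_commute _ _ (by omega) _ _ fun _ _ _ _ => (Algebra.commutes _ _).symm

/-- The algebra generated by the copies of `R̂` acting within the factors `p, …, p + r - 1`. -/
def siteAlg (R : M2 N K) (n p r : ℕ) : Subalgebra K (Op N K n) :=
  Algebra.adjoin K {X | ∃ i, p ≤ i ∧ i + 2 ≤ p + r ∧ site n i R = X}

theorem site_mem_siteAlg {p r i : ℕ} (hp : p ≤ i) (hr : i + 2 ≤ p + r) :
    site n i R ∈ siteAlg R n p r :=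
  Algebra.subset_adjoin ⟨i, hp, hr, rfl⟩

theorem siteAlg_mono {p r p' r' : ℕ} (hp : p' ≤ p) (hr : p + r ≤ p' + r') :
    siteAlg R n p r ≤ siteAlg R n p' r' :=
  Algebra.adjoin_mono fun _ ⟨i, hi, hi', hX⟩ => ⟨i, by omega, by omega, hX⟩

theorem qasym_mem_siteAlg (q : K) (p : ℕ) : ∀ k, qasym q R n p k ∈ siteAlg R n p k
  | 0 => one_mem _
  | 1 => one_mem _
  | k + 2 => by
    have ih := siteAlg_mono (n := n) le_rfl (by omega : p + (k + 1) ≤ p + (k + 2))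
      (qasym_mem_siteAlg q p (k + 1))
    exact Subalgebra.smul_mem _ (mul_mem (mul_mem ih (sub_mem
      (Subalgebra.smul_mem _ (one_mem _) _)
      (Subalgebra.smul_mem _ (site_mem_siteAlg (by omega) (by omega)) _))) ih) _

theorem chain_mem_siteAlg (p : ℕ) : ∀ l, chain n R p l ∈ siteAlg R n p (l + 1)
  | 0 => one_mem _
  | l + 1 => mul_mem (siteAlg_mono le_rfl (by omega) (chain_mem_siteAlg p l))
    (site_mem_siteAlg (by omega) (by omega))

theorem low_of_mem_siteAlg {p r : ℕ} (h : p + r ≤ n) {Z : Op N K n} (hZ : Z ∈ siteAlg R n p r) :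
    Low n (p + r) Z := by
  induction hZ using Algebra.adjoin_induction with
  | mem X hX =>
    obtain ⟨i, _, hi, rfl⟩ := hX
    exact low_site hi h R
  | algebraMap c => rw [Algebra.algebraMap_eq_smul_one]; exact (low_one h).smul c
  | add X Y _ _ hX hY => exact hX.add hY
  | mul X Y _ _ hX hY => exact hX.mul hY

theorem commute_of_mem_siteAlg {p r : ℕ} {X : Op N A n}
    (hX : ∀ i, p ≤ i → i + 2 ≤ p + r → Commute X (scal (site n i R))) {Z : Op N K n}
    (hZ : Z ∈ siteAlg R n p r) : Commute X (scal Z) := by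
  induction hZ using Algebra.adjoin_induction with
  | mem Y hY =>
    obtain ⟨i, hp, hr, rfl⟩ := hY
    exact hX i hp hr
  | algebraMap c =>
    rw [AlgHom.commutes]
    exact (Algebra.commutes c X).symm
  | add Y Z _ _ hY hZ => rw [map_add]; exact hY.add_right hZ
  | mul Y Z _ _ hY hZ => rw [map_mul]; exact hY.mul_right hZ

theorem map_chain (p : ℕ) : ∀ l, chain n (R.map (algebraMap K A)) p l = scal (chain n R p l)
  | 0 => (map_one _).symm
  | l + 1 => by rw [chain, chain, map_chain p l, site_scal, map_mul]

theorem win_chain {w i p : ℕ} (h : i + w ≤ n) (X : M2 N A) :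
    ∀ l, p + l + 1 ≤ w → win n i h (chain w X p l) = chain n X (i + p) l
  | 0, _ => win_one i h
  | l + 1, hl => by
    rw [chain, chain, win_mul, win_chain h X l (by omega), win_site h (by omega), add_assoc]

theorem win_qasym {w i p : ℕ} (h : i + w ≤ n) (q : K) :
    ∀ k, p + k ≤ w → win n i h (qasym q R w p k) = qasym q R n (i + p) k
  | 0, _ => win_one i h
  | 1, _ => win_one i h
  | k + 2, hk => by
    rw [qasym, qasym, win_smul, win_mul, win_mul, win_qasym h q (k + 1) (by omega), win_sub,
      win_smul, win_one, win_smul, win_site h (by omega), add_assoc]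

theorem win_mbar {w : ℕ} (h : 0 + w ≤ n) (X Y : M2 N A) (M : Matrix (Fin N) (Fin N) A) :
    ∀ i, i + 1 ≤ w → win n 0 h (Mbar w X Y M i) = Mbar n X Y M i
  | 0, hi => by rw [Mbar, Mbar, win_site1 h hi]
  | i + 1, hi => by
    rw [Mbar, Mbar, win_mul, win_mul, win_mbar h X Y M i (by omega), win_site h hi,
      win_site h hi, zero_add]

theorem win_mbarSeg {w i : ℕ} (h : 0 + w ≤ n) (X Y : M2 N A) (M : Matrix (Fin N) (Fin N) A) :
    ∀ l, i + l ≤ w → win n 0 h (MbarSeg w X Y M i l) = MbarSeg n X Y M i l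
  | 0, _ => win_one 0 h
  | l + 1, hl => by
    rw [MbarSeg, MbarSeg, win_mul, win_mbarSeg h X Y M l (by omega), win_mbar h _ _ _ _ (by omega)]

theorem Low.trAt (D : Matrix (Fin N) (Fin N) K) {m : ℕ} {X : Op N A n}
    (hX : Low n (m + 1) X) : Low n m (trAt D m X) := by
  obtain ⟨h, X', rfl⟩ := hX
  exact ⟨by omega, qtr1 D X', trAt_win D h X'⟩

end SiteAlgebra

section Copies

variable {K : Type*} [Field K] {A : Type*} [Ring A] [Algebra K A] {N n : ℕ} {q : K}
  {R F Ψ : M2 N K} {M : Matrix (Fin N) (Fin N) A}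

/-- The copy `M_{\overline{i+1}}` of `M` acting on `V^{⊗n}`. -/
noncomputable abbrev copy (n : ℕ) (F : M2 N K) (M : Matrix (Fin N) (Fin N) A) (i : ℕ) : Op N A n :=
  Mbar n (F.map (algebraMap K A)) (F⁻¹.map (algebraMap K A)) M i

/-- The product `M_{\overline{i+1}} ⋯ M_{\overline{i+l}}` acting on `V^{⊗n}`. -/
noncomputable abbrev copies (n : ℕ) (F : M2 N K) (M : Matrix (Fin N) (Fin N) A) (i l : ℕ) : Op N A n :=
  MbarSeg n (F.map (algebraMap K A)) (F⁻¹.map (algebraMap K A)) M i l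

theorem copy_succ (i : ℕ) : copy n F M (i + 1) =
    scal (site n i F) * copy n F M i * scal (site n i F⁻¹) := by
  rw [← site_scal, ← site_scal]; rfl

theorem copies_succ (i l : ℕ) :
    copies n F M i (l + 1) = copies n F M i l * copy n F M (i + l) := rfl

theorem semiconj_scal {a x y : Op N K n} (h : SemiconjBy a x y) :
    SemiconjBy (scal a : Op N A n) (scal x) (scal y) := by
  rw [SemiconjBy, ← map_mul, h.eq, map_mul]

theorem scal_site_mul_inv (hF : IsUnit F) (i : ℕ) :
    scal (site n i F) * scal (site n i F⁻¹) = (1 : Op N A n) := by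
  rw [← map_mul, site_mul_site_inv hF, map_one]

theorem scal_site_inv_mul (hF : IsUnit F) (i : ℕ) :
    scal (site n i F⁻¹) * scal (site n i F) = (1 : Op N A n) := by
  rw [← map_mul, site_inv_mul_site hF, map_one]

theorem semiconj_copy (hF : IsUnit F) (i : ℕ) :
    SemiconjBy (scal (site n i F)) (copy n F M i) (copy n F M (i + 1)) := by
  rw [SemiconjBy, copy_succ, mul_assoc _ _ (scal (site n i F)), scal_site_inv_mul hF, mul_one]

theorem low_copy {i : ℕ} (h : i + 1 ≤ n) : Low n (i + 1) (copy n F M i) := by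
  induction i with
  | zero => exact low_site1 le_rfl h M
  | succ i ih =>
    rw [copy_succ]
    exact ((low_site le_rfl h F).scal.mul ((ih (by omega)).mono (by omega) h)).mul
      (low_site le_rfl h _).scal

theorem low_copies {i l : ℕ} (h : i + l ≤ n) : Low n (i + l) (copies n F M i l) := by
  induction l with
  | zero => exact low_one h
  | succ l ih => exact ((ih (by omega)).mono (by omega) h).mul (low_copy h)

/-- An operator `X̂` with `F̂₂F̂₁X̂₂ = X̂₁F̂₂F̂₁` commutes with all copies of `M` to the right. -/
theorem commute_site_copy (hF : IsUnit F) {X : M2 N K}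
    (hX : ∀ i, i + 3 ≤ n → SemiconjBy (site n (i + 1) F * site n i F) (site n (i + 1) X)
      (site n i X)) {l i : ℕ} (hli : l + 2 ≤ i) (hi : i + 1 ≤ n) :
    Commute (scal (site n l X)) (copy n F M i) := by
  induction i, hli using Nat.le_induction with
  | base =>
    have h₀ := semiconj_scal (A := A) (hX l (by omega))
    have h₁ : SemiconjBy (scal (site n (l + 1) F * site n l F)) (copy n F M l)
        (copy n F M (l + 1 + 1)) := by
      rw [map_mul]
      exact (semiconj_copy hF (l + 1)).mul_left (semiconj_copy hF l)
    have h₂ := (low_copy (F := F) (M := M) (show l + 1 ≤ n by omega)).commute_site le_rfl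
      (by omega) X
    have hinv : scal (site n (l + 1) F * site n l F) *
        scal (site n l F⁻¹ * site n (l + 1) F⁻¹) = (1 : Op N A n) := by
      rw [← map_mul, mul_assoc, ← mul_assoc (site n l F), site_mul_site_inv hF, one_mul,
        site_mul_site_inv hF, map_one]
    have h₃ := (h₀.mul_right h₁).eq.symm.trans
      ((congrArg _ h₂.eq.symm).trans (h₁.mul_right h₀).eq)
    have := congrArg (· * scal (site n l F⁻¹ * site n (l + 1) F⁻¹)) h₃
    simp only [mul_assoc, hinv, mul_one] at this
    exact this
  | succ i hli ih =>
    rw [copy_succ]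
    have comm : ∀ Y : M2 N K, Commute (scal (site n l X)) (scal (site n i Y) : Op N A n) :=
      fun Y => semiconj_scal (site_commute hli (by omega) X Y)
    exact ((comm F).mul_right (ih (by omega))).mul_right (comm F⁻¹)

theorem semiconj_site_inv (hF : IsUnit F) {a : Op N K n} {i j : ℕ}
    (h : SemiconjBy a (site n i F) (site n j F)) :
    SemiconjBy a (site n i F⁻¹) (site n j F⁻¹) := by
  calc a * site n i F⁻¹
      = site n j F⁻¹ * (site n j F * a) * site n i F⁻¹ := by
        rw [← mul_assoc, site_inv_mul_site hF, one_mul]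
    _ = site n j F⁻¹ * a := by
        rw [← h.eq]; simp only [mul_assoc]; rw [site_mul_site_inv hF, mul_one]

theorem semiconj_site_rff (hF : IsUnit F) {a : Op N K n} {i j : ℕ}
    (hR : SemiconjBy a (site n i R) (site n j R)) (h : SemiconjBy a (site n i F) (site n j F)) :
    SemiconjBy a (site n i (RFF R F)) (site n j (RFF R F)) := by
  have h' := semiconj_site_inv hF h
  rw [site_rff, site_rff]
  exact (h.mul_right ((h.mul_right hR).mul_right h')).mul_right h'

theorem semiconj_left_F (h : Compatible R F) {i : ℕ} (hi : i + 3 ≤ n) :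
    SemiconjBy (site n (i + 1) F * site n i F) (site n (i + 1) F) (site n i F) := by
  have := site_braid (n := n) h.2.1 hi
  rw [SemiconjBy, ← mul_assoc, this]

theorem semiconj_left_R (h : Compatible R F) {i : ℕ} (hi : i + 3 ≤ n) :
    SemiconjBy (site n (i + 1) F * site n i F) (site n (i + 1) R) (site n i R) := by
  rw [SemiconjBy, ← mul_assoc, site_cross h hi]

theorem semiconj_right_F (h : Compatible R F) {i : ℕ} (hi : i + 3 ≤ n) :
    SemiconjBy (site n i F * site n (i + 1) F) (site n i F) (site n (i + 1) F) := by
  have := site_braid (n := n) h.2.1 hi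
  rw [SemiconjBy, ← mul_assoc, this]

theorem semiconj_right_R (h : Compatible R F) {i : ℕ} (hi : i + 3 ≤ n) :
    SemiconjBy (site n i F * site n (i + 1) F) (site n i R) (site n (i + 1) R) := by
  rw [SemiconjBy, ← mul_assoc, site_cross' h hi]

/-- The defining relation of the quantum matrix algebra for consecutive copies of `M`. -/
theorem generators_copy (hF : IsUnit F) (h : Compatible R F) (hM : IsGenerators R F M) {i : ℕ}
    (hi : i + 2 ≤ n) :
    scal (site n i R) * (copy n F M i * copy n F M (i + 1)) =
      copy n F M i * copy n F M (i + 1) * scal (site n i (RFF R F)) := by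
  induction i with
  | zero =>
    have := congrArg (win n 0 hi) hM
    have hw : win n 0 hi (MbarSeg 2 (F.map (algebraMap K A)) (F⁻¹.map (algebraMap K A)) M 0 2) =
        copy n F M 0 * copy n F M 1 := by
      rw [win_mbarSeg _ _ _ _ 2 (by omega)]
      simp [MbarSeg]
    rw [win_mul, win_mul, hw, win_site hi le_rfl, win_site hi le_rfl, site_scal, site_scal] at this
    exact this
  | succ i ih =>
    set a : Op N A n := scal (site n i F * site n (i + 1) F) with ha
    have hR : SemiconjBy a (scal (site n i R)) (scal (site n (i + 1) R)) :=
      semiconj_scal (semiconj_right_R h (by omega))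
    have hRFF : SemiconjBy a (scal (site n i (RFF R F))) (scal (site n (i + 1) (RFF R F))) :=
      semiconj_scal
        (semiconj_site_rff hF (semiconj_right_R h (by omega)) (semiconj_right_F h (by omega)))
    have hMM : SemiconjBy a (copy n F M i * copy n F M (i + 1))
        (copy n F M (i + 1) * copy n F M (i + 1 + 1)) := by
      rw [ha, map_mul]
      refine SemiconjBy.mul_right ?_ ?_
      · refine (semiconj_copy hF i).mul_left ?_
        exact ((low_copy (by omega)).commute_site le_rfl (by omega) F).symm
      · refine SemiconjBy.mul_left ?_ (semiconj_copy hF (i + 1))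
        exact commute_site_copy hF (fun _ => semiconj_left_F h) le_rfl (by omega)
    have hinv : a * scal (site n (i + 1) F⁻¹ * site n i F⁻¹) = 1 := by
      rw [ha, ← map_mul, mul_assoc, ← mul_assoc (site n (i + 1) F), site_mul_site_inv hF, one_mul,
        site_mul_site_inv hF, map_one]
    have key := (hR.mul_right hMM).eq.symm.trans
      ((congrArg _ (ih (by omega))).trans (hMM.mul_right hRFF).eq)
    have := congrArg (· * scal (site n (i + 1) F⁻¹ * site n i F⁻¹)) key
    simpa only [mul_assoc, hinv, mul_one] using this

theorem site_mul_copies (hF : IsUnit F) (h : Compatible R F) (hM : IsGenerators R F M)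
    {i l : ℕ} (hi : i + 2 ≤ l) (hl : l ≤ n) :
    scal (site n i R) * copies n F M 0 l = copies n F M 0 l * scal (site n i (RFF R F)) := by
  induction l, hi using Nat.le_induction with
  | base =>
    have hlow : Commute (copies n F M 0 i) (scal (site n i R)) :=
      (low_copies (by omega)).commute_site (by omega) hl R
    rw [copies_succ, copies_succ, zero_add, zero_add, mul_assoc, ← mul_assoc, ← hlow.eq, mul_assoc,
      generators_copy hF h hM hl]
    simp only [mul_assoc]
  | succ l hil ih =>
    have hcomm : Commute (scal (site n i (RFF R F))) (copy n F M l) :=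
      commute_site_copy hF (fun _ hi => semiconj_site_rff hF (semiconj_left_R h hi)
        (semiconj_left_F h hi)) hil hl
    rw [copies_succ, zero_add, ← mul_assoc, ih (by omega), mul_assoc, hcomm.eq, mul_assoc]

end Copies

section Sigma

variable {K : Type*} [Field K] {A : Type*} [Ring A] [Algebra K A] {N n : ℕ} {q : K}
  {R F Ψ : M2 N K} {M : Matrix (Fin N) (Fin N) A}

theorem semiconj_chain_copy (hF : IsUnit F) (h : Compatible R F) {s i l : ℕ} (hl : l < i)
    (hi : s + i + 1 ≤ n) :
    SemiconjBy (scal (chain n F s i)) (copy n F M (s + l)) (copy n F M (s + l + 1)) := by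
  induction i, hl using Nat.le_induction with
  | base =>
    rw [chain, map_mul]
    refine SemiconjBy.mul_left ?_ (semiconj_copy hF _)
    refine (commute_of_mem_siteAlg (fun i _ hi' => ?_) (chain_mem_siteAlg s l)).symm
    exact (commute_site_copy hF (fun _ => semiconj_left_F h) (by omega) (by omega)).symm
  | succ i hl ih =>
    rw [chain, map_mul]
    exact (ih (by omega)).mul_left
      ((low_copy (by omega)).commute_site (m := s + l + 1) (by omega) (by omega) F).symm

theorem semiconj_chain_copies (hF : IsUnit F) (h : Compatible R F) {s i l : ℕ} (hl : l ≤ i)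
    (hi : s + i + 1 ≤ n) :
    SemiconjBy (scal (chain n F s i)) (copies n F M s l) (copies n F M (s + 1) l) := by
  induction l with
  | zero => exact SemiconjBy.one_right _
  | succ l ih =>
    rw [copies_succ, copies_succ, Nat.add_right_comm s 1 l]
    exact (ih (by omega)).mul_right (semiconj_chain_copy hF h hl hi)

theorem semiconj_chain_site (h : Compatible R F) {s i l : ℕ} (hl : l + 2 ≤ i)
    (hi : s + i + 1 ≤ n) :
    SemiconjBy (scal (chain n F s i)) (scal (site n (s + l) R) : Op N A n)
      (scal (site n (s + l + 1) R)) := by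
  induction i, hl using Nat.le_induction with
  | base =>
    rw [chain, chain, mul_assoc, map_mul]
    refine SemiconjBy.mul_left ?_ (semiconj_scal (semiconj_right_R h (by omega)))
    refine (commute_of_mem_siteAlg (fun i _ hi' => ?_) (chain_mem_siteAlg s l)).symm
    exact (semiconj_scal (site_commute (by omega) (by omega) F R)).symm
  | succ i hl ih =>
    rw [chain, map_mul]
    exact (ih (by omega)).mul_left
      (semiconj_scal (site_commute (by omega) (by omega) R F)).symm

theorem semiconj_chain_qasym (h : Compatible R F) {s i : ℕ} (hi : s + i + 1 ≤ n) :
    ∀ k ≤ i, SemiconjBy (scal (chain n F s i)) (scal (qasym q R n s k) : Op N A n)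
      (scal (qasym q R n (s + 1) k))
  | 0, _ => by simp only [qasym, map_one]; exact SemiconjBy.one_right _
  | 1, _ => by simp only [qasym, map_one]; exact SemiconjBy.one_right _
  | k + 2, hk => by
    have ih := semiconj_chain_qasym h hi (k + 1) (by omega)
    have hs := semiconj_chain_site (A := A) h hk hi
    simp only [qasym, map_smul, map_mul, map_sub, map_one, Nat.add_right_comm s 1 k]
    have smul : ∀ {a x y : Op N A n} (c : K), SemiconjBy a x y → SemiconjBy a (c • x) (c • y) :=
      fun c hxy => by rw [SemiconjBy, mul_smul_comm, smul_mul_assoc, hxy.eq]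
    exact smul _ ((ih.mul_right ((smul _ (SemiconjBy.one_right _)).sub_right
      (smul _ hs))).mul_right ih)

/-- Conjugation by `F̂_s ⋯ F̂_{s+i-1}` shifts the range of the quantum trace. -/
theorem trRange_of_semiconj (hF : IsUnit F) (hΨ : IsClosedPair F Ψ) (hYB : YB F) {s i : ℕ}
    (hi : s + i + 1 ≤ n) {X Y : Op N A n} (hX : Low n (s + i) X)
    (hXY : SemiconjBy (scal (chain n F s i)) X Y) :
    trRange (Dmat Ψ) (s + 1) i Y = trRange (Dmat Ψ) s i X := by
  induction i generalizing X Y with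
  | zero =>
    have : X = Y := by simpa [SemiconjBy, chain] using hXY
    rw [this]; rfl
  | succ i ih =>
    have hlow : Low n (s + i + 1) (scal (chain n F s i) : Op N A n) :=
      (low_of_mem_siteAlg (by omega) (chain_mem_siteAlg s i)).scal
    have hconj := trAt_conj hF hΨ hYB (m := s + i) (by omega) hX
    rw [site_scal, site_scal] at hconj
    rw [trRange_succ, trRange_succ]
    refine ih (by omega) (Low.trAt _ hX) ?_
    have e : scal (chain n F s i) * (scal (site n (s + i) F) * X * scal (site n (s + i) F⁻¹)) =
        Y * scal (chain n F s i) := by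
      have := congrArg (· * (scal (site n (s + i) F⁻¹) : Op N A n)) hXY.eq
      simpa only [chain, map_mul, mul_assoc, scal_site_mul_inv hF, mul_one] using this
    rw [SemiconjBy, ← hconj, add_right_comm s 1 i, CHN.trAt, ← ptrace_low_mul _ le_rfl hlow,
      ← ptrace_mul_low _ le_rfl hlow, e]

/-- The elementary symmetric function can be computed on any sequence of consecutive copies
of `M`. -/
theorem trRange_qasym_copies (hF : IsUnit F) (hΨ : IsClosedPair F Ψ) (h : Compatible R F)
    {s i : ℕ} (hi : s + i ≤ n) :
    trRange (Dmat Ψ) s i (scal (qasym q R n s i) * copies n F M s i) =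
      sigmaF q R F Ψ M i • (1 : Op N A n) := by
  induction s with
  | zero =>
    rw [sigmaF, ← trRange_win_zero _ hi, win_mul, win_mbarSeg _ _ _ _ _ (by omega), win_map,
      win_qasym _ _ _ (by omega), zero_add]
    rfl
  | succ s ih =>
    rw [← ih (by omega)]
    refine trRange_of_semiconj hF hΨ h.2.1 (by omega) ?_ ?_
    · exact ((low_of_mem_siteAlg (by omega) (qasym_mem_siteAlg q s i)).scal).mul
        (low_copies (by omega))
    · exact (semiconj_chain_qasym h (by omega) i le_rfl).mul_right
        (semiconj_chain_copies hF h le_rfl (by omega))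

/-- Operators generated by `R̂` are cyclic under the quantum trace against
`M_{\overline{1}} ⋯ M_{\overline{r}}`. -/
theorem trRange_mul_scal_mul_copies (hF : IsUnit F) (hΨ : IsClosedPair F Ψ) (h : Compatible R F)
    (hM : IsGenerators R F M) {s l r : ℕ} (hl : s + l ≤ r) (hr : r ≤ n) {Z : Op N K n}
    (hZ : Z ∈ siteAlg R n s l) (X : Op N A n) :
    trRange (Dmat Ψ) s l (X * scal Z * copies n F M 0 r) =
      trRange (Dmat Ψ) s l (scal Z * X * copies n F M 0 r) := by
  induction hZ using Algebra.adjoin_induction generalizing X with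
  | mem Y hY =>
    obtain ⟨i, hs, hi, rfl⟩ := hY
    rw [mul_assoc X, site_mul_copies hF h hM (by omega) hr, ← mul_assoc, ← site_scal,
      trRange_mul_rff hF hΨ h hs hi (by omega), site_scal, mul_assoc]
  | algebraMap c => rw [AlgHom.commutes, Algebra.commutes c X]
  | add Y Z _ _ hY hZ => simp only [map_add, mul_add, add_mul, hY, hZ]
  | mul Y Z _ _ hY hZ =>
    rw [scal_mul, ← mul_assoc X, hZ, ← mul_assoc, hY, ← mul_assoc]

end Sigma

section Telescoping

variable {K : Type*} [Field K] {A : Type*} [Ring A] [Algebra K A] {N n : ℕ} {q : K}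
  {R F Ψ : M2 N K} {M : Matrix (Fin N) (Fin N) A}

theorem copies_add (i l : ℕ) : ∀ l', copies n F M i (l + l') =
    copies n F M i l * copies n F M (i + l) l'
  | 0 => (mul_one _).symm
  | l' + 1 => by rw [← add_assoc, copies_succ, copies_add i l l', copies_succ, mul_assoc, add_assoc]

theorem win_mpow (p : ℕ) (h : 0 + (1 + p) ≤ n) :
    win n 0 (by omega) (MpowF R F Ψ M p) =
      trRange (Dmat Ψ) 1 p (scal (chain n R 0 p) * copies n F M 0 (p + 1)) := by
  rw [MpowF, ← trRange_win _ h, win_mul, win_chain _ _ _ (by omega), win_mbarSeg _ _ _ _ _ (by omega),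
    map_chain]

theorem win_mwedge (p : ℕ) (h : 0 + (1 + p) ≤ n) :
    win n 0 (by omega) (MwedgeF q R F Ψ M p) =
      trRange (Dmat Ψ) 1 p (scal (qasym q R n 0 (p + 1)) * copies n F M 0 (p + 1)) := by
  rw [MwedgeF, ← trRange_win _ h, win_mul, win_mbarSeg _ _ _ _ _ (by omega), win_map,
    win_qasym _ _ _ (by omega)]
  rfl

theorem trRange_chain_qasym_copies (hF : IsUnit F) (hΨ : IsClosedPair F Ψ) (h : Compatible R F)
    (p i : ℕ) (hn : p + i + 1 ≤ n) :
    trRange (Dmat Ψ) 1 (p + i) (scal (chain n R 0 p * qasym q R n (p + 1) i) *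
        copies n F M 0 (p + i + 1)) =
      win n 0 (by omega) (MpowF R F Ψ M p) * (sigmaF q R F Ψ M i • (1 : Op N A n)) := by
  have hlow : Low n (p + 1) (copies n F M 0 (p + 1)) := by
    simpa using low_copies (F := F) (M := M) (i := 0) (l := p + 1) (by omega)
  have hchain : Low n (p + 1) (scal (chain n R 0 p) : Op N A n) := by
    simpa using (low_of_mem_siteAlg (by omega) (chain_mem_siteAlg (R := R) (n := n) 0 p)).scal
  have hcomm : Commute (copies n F M 0 (p + 1)) (scal (qasym q R n (p + 1) i)) :=
    commute_of_mem_siteAlg (fun _ hi hi' => hlow.commute_site hi (by omega) R)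
      (qasym_mem_siteAlg q (p + 1) i)
  rw [show p + i + 1 = p + 1 + i by omega, copies_add, zero_add, scal_mul, mul_assoc,
    ← mul_assoc (scal (qasym _ _ _ _ _)), ← hcomm.eq, mul_assoc, ← mul_assoc, trRange_add,
    trRange_low_mul _ (by omega) _ (hchain.mul hlow), add_comm 1 p,
    trRange_qasym_copies hF hΨ h (by omega),
    trRange_mul_low _ le_rfl _ (low_smul_one (by omega) _), ← win_mpow p (by omega)]

/-- One step of the recursion expressing the wedge power through the powers of `M`. -/
theorem qInt_smul_trRange_chain (hq0 : q ≠ 0) (hq1 : q ^ 2 ≠ 1)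
    (hqn : ∀ n : ℕ, 1 ≤ n → qInt q n ≠ 0) (hH : IsHecke q R) (hF : IsUnit F)
    (hΨ : IsClosedPair F Ψ) (h : Compatible R F) (hM : IsGenerators R F M)
    (p k : ℕ) (hn : p + k + 2 ≤ n) :
    qInt q (k + 2) • trRange (Dmat Ψ) 1 (p + k + 1)
        (scal (chain n R 0 p * qasym q R n p (k + 2)) * copies n F M 0 (p + k + 2)) =
      q ^ (k + 1) • trRange (Dmat Ψ) 1 (p + k + 1)
        (scal (chain n R 0 p * qasym q R n (p + 1) (k + 1)) * copies n F M 0 (p + k + 2)) -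
      qInt q (k + 1) • trRange (Dmat Ψ) 1 (p + k + 1)
        (scal (chain n R 0 (p + 1) * qasym q R n (p + 1) (k + 1)) *
          copies n F M 0 (p + k + 2)) := by
  set B := qasym q R n (p + 1) (k + 1) with hB
  set c := chain n R 0 p with hc
  have hBmem : B ∈ siteAlg R n 1 (p + k + 1) :=
    siteAlg_mono (by omega) (by omega) (qasym_mem_siteAlg q (p + 1) (k + 1))
  have cyc : ∀ X : Op N K n, trRange (Dmat Ψ) 1 (p + k + 1)
      (scal (X * B) * copies n F M 0 (p + k + 2)) =
      trRange (Dmat Ψ) 1 (p + k + 1) (scal (B * X) * copies n F M 0 (p + k + 2)) := fun X => by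
    rw [scal_mul, scal_mul]
    exact trRange_mul_scal_mul_copies hF hΨ h hM (by omega) (by omega) hBmem _
  have hcB : B * c = c * B := by
    have hclow : Low n (p + 1) c := by
      simpa using low_of_mem_siteAlg (by omega) (chain_mem_siteAlg (R := R) (n := n) 0 p)
    refine (commute_qasym q (k + 1) fun i hi hi' => ?_).symm
    have := hclow.commute_site hi (by omega) R
    rwa [← site_scal, site_map_self] at this
  have hBB : B * B = B := qasym_mul_self hq0 hq1 hqn hH (by omega)
  have hR : trRange (Dmat Ψ) 1 (p + k + 1)
      (scal (chain n R 0 (p + 1) * B) * copies n F M 0 (p + k + 2)) =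
      trRange (Dmat Ψ) 1 (p + k + 1)
        (scal (c * B * site n p R) * copies n F M 0 (p + k + 2)) := by
    rw [cyc, chain, zero_add, ← hc, ← mul_assoc, hcB]
  have hA : qInt q (k + 2) • trRange (Dmat Ψ) 1 (p + k + 1)
      (scal (c * qasym q R n p (k + 2)) * copies n F M 0 (p + k + 2)) =
      trRange (Dmat Ψ) 1 (p + k + 1)
        (scal (c * B * (q ^ (k + 1) • 1 - qInt q (k + 1) • site n p R)) *
          copies n F M 0 (p + k + 2)) := by
    rw [← map_smul, ← smul_mul_assoc, ← map_smul, ← mul_smul_comm,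
      qasym_succ_left hq0 hq1 hqn hH k hn, ← hB, ← mul_assoc, cyc, ← mul_assoc, ← mul_assoc, hcB,
      mul_assoc c, hBB]
  rw [hA, hR]
  simp only [mul_sub, mul_smul_comm, mul_one, map_sub, map_smul, sub_mul, smul_mul_assoc]

theorem sum_pow_trRange_chain (hq0 : q ≠ 0) (hq1 : q ^ 2 ≠ 1)
    (hqn : ∀ n : ℕ, 1 ≤ n → qInt q n ≠ 0) (hH : IsHecke q R) (hF : IsUnit F)
    (hΨ : IsClosedPair F Ψ) (h : Compatible R F) (hM : IsGenerators R F M)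
    {j : ℕ} (hn : j + 1 ≤ n) (m : ℕ) (hm : m ≤ j) :
    ∑ i ∈ Finset.range (m + 1), (-q) ^ i • trRange (Dmat Ψ) 1 j
        (scal (chain n R 0 (j - i) * qasym q R n (j - i + 1) i) * copies n F M 0 (j + 1)) =
      ((-1) ^ m * qInt q (m + 1)) • trRange (Dmat Ψ) 1 j
        (scal (chain n R 0 (j - m) * qasym q R n (j - m) (m + 1)) * copies n F M 0 (j + 1)) := by
  induction m with
  | zero => simp [qInt_one hq0 hq1, qasym]
  | succ m ih =>
    obtain ⟨p, rfl⟩ : ∃ p, j = p + m + 1 := ⟨j - (m + 1), by omega⟩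
    have hrec := qInt_smul_trRange_chain hq0 hq1 hqn hH hF hΨ h hM p m hn
    rw [Finset.sum_range_succ, ih (by omega), show p + m + 1 - (m + 1) = p by omega,
      show p + m + 1 - m = p + 1 by omega, mul_smul _ (qInt q (m + 1 + 1)), hrec]
    module

end Telescoping

/-- Cayley–Hamilton–Newton identity, antisymmetric form, (27).
For a Hecke R-matrix `R̂` (with `m_q ≠ 0` for all `m ≥ 1`), a compatible closed
R-matrix `F̂`, and a matrix of generators `M` of `M(R̂,F̂)`:  for every `k = j+1 ≥ 1`,
`(−1)^{k−1} k_q M^{∧k} = ∑_{i=0}^{k−1} (−q)^i M^{\overline{k−i}} σ_i(M)`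
as `N×N` matrices over `A` (realized as one-site operators). -/
theorem CHN_antisymmetric {K : Type} [Field K] {A : Type} [Ring A] [Algebra K A]
    {N : ℕ} (q : K) (R F Ψ : M2 N K) (M : Matrix (Fin N) (Fin N) A)
    (hq0 : q ≠ 0) (hq1 : q ^ 2 ≠ 1) (hqn : ∀ n : ℕ, 1 ≤ n → qInt q n ≠ 0)
    (hH : IsHecke q R) (hF : IsUnit F) (hΨ : IsClosedPair F Ψ)
    (h : Compatible R F) (hM : IsGenerators R F M) :
    ∀ j : ℕ,
      ((-1 : K) ^ j * qInt q (j + 1)) • MwedgeF q R F Ψ M j =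
        ∑ i ∈ Finset.range (j + 1),
          ((-q) ^ i) •
            (MpowF R F Ψ M (j - i) * (sigmaF q R F Ψ M i • (1 : Op N A 1))) := by
  intro j
  have hn : 0 + 1 ≤ j + 1 := by omega
  refine win_injective one_pos hn ?_
  have hsum : ∀ f : ℕ → Op N A 1, win (j + 1) 0 hn (∑ i ∈ Finset.range (j + 1), f i) =
      ∑ i ∈ Finset.range (j + 1), win (j + 1) 0 hn (f i) :=
    fun f => map_sum (AddMonoidHom.mk' (win (j + 1) 0 hn) (win_add 0 hn)) f _
  have hσ : ∀ c : A, win (j + 1) 0 hn (c • (1 : Op N A 1)) = c • 1 := fun c => by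
    rw [← win_one 0 hn]
    ext a b
    simp only [win, Matrix.smul_apply]
    split_ifs <;> simp
  have key := sum_pow_trRange_chain hq0 hq1 hqn hH hF hΨ h hM (n := j + 1) le_rfl j le_rfl
  rw [Nat.sub_self, chain, one_mul, ← win_mwedge j (by omega)] at key
  rw [hsum, win_smul, ← key]
  refine Finset.sum_congr rfl fun i hi => ?_
  obtain ⟨p, rfl⟩ := Nat.exists_eq_add_of_le' (Nat.lt_succ_iff.mp (Finset.mem_range.mp hi))
  rw [win_smul, win_mul, hσ, Nat.add_sub_cancel, trRange_chain_qasym_copies hF hΨ h p i le_rfl]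

end CHN
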